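/- arXiv:2007.10070 — 2 statements merged into one kernel-verified Lean document; each statement's English description precedes it below -/
import Mathlib

section
/- (Extension theorem for smoothness below one.) Let d ∈ ℕ, let Ω ⊊ ℝ^d be an interior (ε,δ)-corkscrew domain, let 1 ≤ p < ∞, 1 ≤ q ≤ ∞ and 0 < s < 1. Then there exist constants ℓ₀ > 0 and C ≥ 1, depending only on d, ε, δ, s, p and q, such that for every measurable f : Ω → ℝ with ‖f‖_{L^p(Ω)} + ‖f‖_{Ḟ^{s,Cℓ₀}_{p,q,1}(Ω)} < ∞ there exists a measurable F : ℝ^d → ℝ with F = f almost everywhere on Ω and ‖F‖_{L^p(ℝ^d)} + ‖F‖_{Ḟ^{s,1}_{p,q,1}(ℝ^d)} ≤ C ( ‖f‖_{L^p(Ω)} + ‖f‖_{Ḟ^{s,Cℓ₀}_{p,q,1}(Ω)} ). -/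
open Set MeasureTheory ENNReal

noncomputable section

/-- `Ω` is an interior `(ε,δ)`-corkscrew domain: a nonempty open proper subset of
`ℝ^d` such that for every boundary point `z` and every radius `0 < r ≤ δ` there is a
ball `B(y, εr) ⊆ B(z,r) ∩ Ω`. -/
def IsCorkscrew (d : ℕ) (ε δ : ℝ) (Ω : Set (EuclideanSpace ℝ (Fin d))) : Prop :=
  IsOpen Ω ∧ Ω.Nonempty ∧ Ω ≠ Set.univ ∧
    ∀ z ∈ frontier Ω, ∀ r : ℝ, 0 < r → r ≤ δ →
      ∃ y : EuclideanSpace ℝ (Fin d), Metric.ball y (ε * r) ⊆ Metric.ball z r ∩ Ω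

/-- The inner quantity `t^{-σ-d/u} ( ∫_{B(x,t) ∩ U} |f(x)-f(y)|^u dy )^{1/u}`, with
the essential supremum over `y ∈ B(x,t) ∩ U` replacing the integral when `u = ∞`. -/
noncomputable def triebelInner (d : ℕ) (U : Set (EuclideanSpace ℝ (Fin d)))
    (f : EuclideanSpace ℝ (Fin d) → ℝ) (σ : ℝ) (u : ℝ≥0∞)
    (x : EuclideanSpace ℝ (Fin d)) (t : ℝ) : ℝ≥0∞ :=
  ENNReal.ofReal (t ^ (-(σ + (d : ℝ) / u.toReal))) *
    (if u = ⊤ then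
      essSup (fun y => ENNReal.ofReal |f x - f y|)
        (volume.restrict (Metric.ball x t ∩ U))
    else
      (∫⁻ y in Metric.ball x t ∩ U, ENNReal.ofReal |f x - f y| ^ u.toReal) ^
        (1 / u.toReal))

/-- The Triebel–Lizorkin-type seminorm `‖f‖_{Ḟ^{σ,ρ}_{p,q,u}(U)}`:
`( ∫_U ( ∫_0^ρ (t^{-σ-d/u} (∫_{U_{x,t}} |f(x)-f(y)|^u dy)^{1/u})^q dt/t )^{p/q} dx )^{1/p}`,
with the essential supremum over `t ∈ (0,ρ)` replacing the inner integral when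
`q = ∞` (and similarly in `y` when `u = ∞`). -/
noncomputable def triebelSeminorm (d : ℕ) (U : Set (EuclideanSpace ℝ (Fin d)))
    (f : EuclideanSpace ℝ (Fin d) → ℝ) (σ ρ p : ℝ) (q u : ℝ≥0∞) : ℝ≥0∞ :=
  (∫⁻ x in U,
      (if q = ⊤ then
        essSup (fun t => triebelInner d U f σ u x t)
          (volume.restrict (Set.Ioo (0 : ℝ) ρ))
      else
        (∫⁻ t in Set.Ioo (0 : ℝ) ρ,
            triebelInner d U f σ u x t ^ q.toReal * ENNReal.ofReal t⁻¹) ^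
          (1 / q.toReal)) ^ p) ^ (1 / p)

/-- The `L^p(U)` norm of `f` (as an extended nonnegative real). -/
noncomputable def lpNormOn (d : ℕ) (U : Set (EuclideanSpace ℝ (Fin d)))
    (f : EuclideanSpace ℝ (Fin d) → ℝ) (p : ℝ) : ℝ≥0∞ :=
  eLpNorm f (ENNReal.ofReal p) (volume.restrict U)

lemma eLpNorm_ennreal_const_mul {α : Type*} [MeasurableSpace α] {μ : Measure α} (c : ℝ≥0∞)
    {φ : α → ℝ≥0∞} (hφ : Measurable φ) (q : ℝ≥0∞) :
    eLpNorm (fun t => c * φ t) q μ = c * eLpNorm φ q μ := by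
  rcases eq_or_ne q 0 with rfl | hq0
  · simp
  rcases eq_or_ne q ⊤ with rfl | hq
  · simp only [eLpNorm_exponent_top, eLpNormEssSup, enorm_eq_self]
    exact ENNReal.essSup_const_mul
  · have hpos : 0 < q.toReal := ENNReal.toReal_pos hq0 hq
    simp only [eLpNorm_eq_lintegral_rpow_enorm_toReal hq0 hq, enorm_eq_self]
    simp_rw [ENNReal.mul_rpow_of_nonneg _ _ hpos.le]
    rw [lintegral_const_mul _ (by fun_prop), ENNReal.mul_rpow_of_nonneg _ _ (by positivity),
      ← ENNReal.rpow_mul, mul_one_div_cancel hpos.ne', ENNReal.rpow_one]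

lemma measurable_eLpNorm_right {α β : Type*} [MeasurableSpace α] [MeasurableSpace β]
    {ν : Measure β} [SFinite ν] {G : α → β → ℝ≥0∞} (hG : Measurable (Function.uncurry G))
    (q : ℝ≥0∞) : Measurable fun z => eLpNorm (G z) q ν := by
  rcases eq_or_ne q 0 with rfl | hq0
  · simp
  rcases eq_or_ne q ⊤ with rfl | hq
  · simp only [eLpNorm_exponent_top, eLpNormEssSup, enorm_eq_self]
    refine measurable_of_Iic fun c => ?_
    have : (fun z => essSup (fun t => G z t) ν) ⁻¹' Iic c =
        {z | ν (Prod.mk z ⁻¹' {x : α × β | c < Function.uncurry G x}) = 0} := by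
      ext z
      have h1 : (essSup (fun t => G z t) ν ≤ c) ↔ ∀ᵐ t ∂ν, G z t ≤ c :=
        ⟨fun h => (ENNReal.ae_le_essSup _).mono fun t ht => ht.trans h,
          fun h => essSup_le_of_ae_le c h⟩
      simp only [mem_preimage, mem_Iic, h1, ae_iff, mem_ofPred_eq, not_le]
      rfl
    rw [this]
    exact measurable_measure_prodMk_left (measurableSet_lt measurable_const hG)
      (measurableSet_singleton 0)
  · simp only [eLpNorm_eq_lintegral_rpow_enorm_toReal hq0 hq, enorm_eq_self]
    have : Measurable fun x : α × β => Function.uncurry G x ^ q.toReal := by fun_prop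
    exact (Measurable.lintegral_prod_right' this).pow_const _

/-- Truncated form of Minkowski's integral inequality. -/
lemma lintegral_rpow_le_of_le_lintegral {α β : Type*} [MeasurableSpace α] [MeasurableSpace β]
    {m : Measure α} [SFinite m] {ν : Measure β} [SFinite ν] {G : α → β → ℝ≥0∞}
    (hG : Measurable (Function.uncurry G)) {q : ℝ} (hq : 1 < q) {H : β → ℝ≥0∞} (hH : Measurable H)
    (hHG : ∀ t, H t ≤ ∫⁻ z, G z t ∂m) (hfin : ∫⁻ t, H t ^ q ∂ν ≠ ⊤) :
    (∫⁻ t, H t ^ q ∂ν) ^ (1 / q) ≤ ∫⁻ z, (∫⁻ t, G z t ^ q ∂ν) ^ (1 / q) ∂m := by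
  have hq0 : 0 < q := by linarith
  rcases eq_or_ne (∫⁻ t, H t ^ q ∂ν) 0 with h0 | h0
  · rw [h0, ENNReal.zero_rpow_of_pos (by positivity)]; exact zero_le
  have hpq : q.HolderConjugate (Real.conjExponent q) := Real.HolderConjugate.conjExponent hq
  set r := Real.conjExponent q with hr
  have hG1 : ∀ z, Measurable (G z) := fun z => hG.comp measurable_prodMk_left
  have hG2 : ∀ t, Measurable fun z => G z t := fun t => hG.comp measurable_prodMk_right
  have hm : Measurable fun x : α × β => Function.uncurry G x ^ q := by fun_prop
  have hm2 : Measurable fun z => (∫⁻ t, G z t ^ q ∂ν) ^ (1 / q) :=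
    (Measurable.lintegral_prod_right' hm).pow_const _
  have key : ∫⁻ t, H t ^ q ∂ν ≤
      (∫⁻ z, (∫⁻ t, G z t ^ q ∂ν) ^ (1 / q) ∂m) * (∫⁻ t, H t ^ q ∂ν) ^ (1 / r) := by
    calc ∫⁻ t, H t ^ q ∂ν ≤ ∫⁻ t, (∫⁻ z, G z t ∂m) * H t ^ (q - 1) ∂ν := by
          refine lintegral_mono fun t => ?_
          calc H t ^ q = H t * H t ^ (q - 1) := by
                conv_rhs => rw [← ENNReal.rpow_one (H t), ← ENNReal.rpow_mul]
                rw [one_mul, ← ENNReal.rpow_add_of_nonneg _ _ (by norm_num) (by linarith)]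
                congr 1; ring
            _ ≤ _ := by gcongr; exact hHG t
      _ = ∫⁻ t, ∫⁻ z, G z t * H t ^ (q - 1) ∂m ∂ν := by
          refine lintegral_congr fun t => ?_
          rw [lintegral_mul_const _ (hG2 t)]
      _ = ∫⁻ z, ∫⁻ t, G z t * H t ^ (q - 1) ∂ν ∂m := by
          refine lintegral_lintegral_swap (f := fun t z => G z t * H t ^ (q - 1)) ?_
          refine Measurable.aemeasurable ?_
          exact (hG.comp measurable_swap).mul ((hH.comp measurable_fst).pow_const _)
      _ ≤ ∫⁻ z, (∫⁻ t, G z t ^ q ∂ν) ^ (1 / q) * (∫⁻ t, H t ^ q ∂ν) ^ (1 / r) ∂m := by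
          refine lintegral_mono fun z => ?_
          refine (ENNReal.lintegral_mul_le_Lp_mul_Lq ν hpq (hG1 z).aemeasurable
            (hH.pow_const (q - 1)).aemeasurable).trans_eq ?_
          congr 2
          refine lintegral_congr fun t => ?_
          rw [← ENNReal.rpow_mul, hpq.sub_one_mul_conj]
      _ = _ := lintegral_mul_const _ hm2
  have hsplit : ∫⁻ t, H t ^ q ∂ν =
      (∫⁻ t, H t ^ q ∂ν) ^ (1 / q) * (∫⁻ t, H t ^ q ∂ν) ^ (1 / r) := by
    rw [← ENNReal.rpow_add _ _ h0 hfin, one_div, one_div, hpq.inv_add_inv_eq_one, ENNReal.rpow_one]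
  have hr0 : 0 < r := hpq.symm.pos
  refine (ENNReal.mul_le_mul_iff_left (c := (∫⁻ t, H t ^ q ∂ν) ^ (1 / r)) ?_ ?_).1
    (hsplit.symm.trans_le key)
  · simp [ENNReal.rpow_eq_zero_iff, h0, hfin]
  · exact ENNReal.rpow_ne_top_of_nonneg (by positivity) hfin

/-- Minkowski's integral inequality. -/
lemma eLpNorm_lintegral_le {α β : Type*} [MeasurableSpace α] [MeasurableSpace β]
    {m : Measure α} [SFinite m] {ν : Measure β} [SigmaFinite ν] {G : α → β → ℝ≥0∞}
    (hG : Measurable (Function.uncurry G)) {q : ℝ≥0∞} (hq : 1 ≤ q) :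
    eLpNorm (fun t => ∫⁻ z, G z t ∂m) q ν ≤ ∫⁻ z, eLpNorm (G z) q ν ∂m := by
  have hGs : Measurable fun x : β × α => G x.2 x.1 := hG.comp measurable_swap
  have hmI : Measurable fun t => ∫⁻ z, G z t ∂m := hGs.lintegral_prod_right'
  rcases eq_or_ne q ⊤ with rfl | hqt
  · have hh := measurable_eLpNorm_right (ν := ν) hG ⊤
    have h1 : ∀ᵐ z ∂m, ∀ᵐ t ∂ν, G z t ≤ eLpNorm (G z) ⊤ ν := by
      refine Filter.Eventually.of_forall fun z => ?_
      simp only [eLpNorm_exponent_top, eLpNormEssSup, enorm_eq_self]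
      exact ENNReal.ae_le_essSup _
    have h2 : ∀ᵐ t ∂ν, ∀ᵐ z ∂m, G z t ≤ eLpNorm (G z) ⊤ ν := by
      refine (Measure.ae_ae_comm ?_).1 h1
      exact measurableSet_le hG (hh.comp measurable_fst)
    rw [eLpNorm_exponent_top, eLpNormEssSup]
    refine essSup_le_of_ae_le _ ?_
    filter_upwards [h2] with t ht
    rw [enorm_eq_self]
    exact lintegral_mono_ae ht
  have hq0 : q ≠ 0 := (zero_lt_one.trans_le hq).ne'
  simp only [eLpNorm_eq_lintegral_rpow_enorm_toReal hq0 hqt, enorm_eq_self]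
  have hq1 : 1 ≤ q.toReal := by
    rw [← ENNReal.toReal_one]; exact (ENNReal.toReal_le_toReal (by simp) hqt).2 hq
  rcases hq1.eq_or_lt with h | hq1
  · rw [← h]
    simp only [ENNReal.rpow_one, div_one]
    exact (lintegral_lintegral_swap hGs.aemeasurable).le
  set H : ℕ → β → ℝ≥0∞ := fun n =>
    (spanningSets ν n).indicator fun t => min (∫⁻ z, G z t ∂m) n with hHdef
  have hHm : ∀ n, Measurable (H n) := fun n =>
    (hmI.min measurable_const).indicator (measurableSet_spanningSets ν n)
  have hHle : ∀ n t, H n t ≤ ∫⁻ z, G z t ∂m := fun n t =>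
    indicator_apply_le' (fun _ => min_le_left _ _) (fun _ => zero_le)
  have hmono : Monotone fun n t => H n t ^ q.toReal := by
    intro a b hab t
    refine ENNReal.rpow_le_rpow ?_ (by linarith)
    refine (indicator_le_indicator_of_subset (monotone_spanningSets ν hab)
      (fun _ => zero_le) t).trans
      (indicator_le_indicator ?_)
    gcongr
  have hsup : ∀ t, ⨆ n, H n t ^ q.toReal = (∫⁻ z, G z t ∂m) ^ q.toReal := by
    intro t
    refine le_antisymm (iSup_le fun n => ENNReal.rpow_le_rpow ?_ (by linarith)) ?_
    · exact hHle n t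
    · have h1 : Filter.Tendsto (fun n => H n t) Filter.atTop (nhds (∫⁻ z, G z t ∂m)) := by
        have h2 : Filter.Tendsto (fun n : ℕ => min (∫⁻ z, G z t ∂m) (n : ℝ≥0∞)) Filter.atTop
            (nhds (min (∫⁻ z, G z t ∂m) ⊤)) :=
          tendsto_const_nhds.min ENNReal.tendsto_nat_nhds_top
        rw [min_eq_left le_top] at h2
        refine h2.congr' ?_
        filter_upwards [Filter.eventually_ge_atTop (spanningSetsIndex ν t)] with n hn
        rw [hHdef]
        simp only
        rw [indicator_of_mem]
        exact monotone_spanningSets ν hn (mem_spanningSetsIndex ν t)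
      have h3 := (ENNReal.continuous_rpow_const (y := q.toReal)).continuousAt.tendsto.comp h1
      exact le_of_tendsto' h3 fun n => le_iSup (fun n => H n t ^ q.toReal) n
  simp_rw [← hsup]
  rw [lintegral_iSup (fun n => (hHm n).pow_const _) hmono]
  have hcont : (⨆ n, ∫⁻ t, H n t ^ q.toReal ∂ν) ^ (1 / q.toReal) =
      ⨆ n, (∫⁻ t, H n t ^ q.toReal ∂ν) ^ (1 / q.toReal) :=
    (ENNReal.orderIsoRpow (1 / q.toReal) (by positivity)).map_iSup _
  rw [hcont]
  refine iSup_le fun n => lintegral_rpow_le_of_le_lintegral hG hq1 (hHm n) ?_ ?_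
  · intro t
    exact hHle n t
  · have hle : ∫⁻ t, H n t ^ q.toReal ∂ν ≤
        ∫⁻ t in spanningSets ν n, (n : ℝ≥0∞) ^ q.toReal ∂ν := by
      rw [← lintegral_indicator (measurableSet_spanningSets ν n)]
      refine lintegral_mono fun t => ?_
      by_cases ht : t ∈ spanningSets ν n
      · simp only [hHdef, indicator_of_mem ht]
        exact ENNReal.rpow_le_rpow (min_le_right _ _) (by linarith)
      · simp only [hHdef, indicator_of_notMem ht]
        rw [ENNReal.zero_rpow_of_pos (by linarith)]
    refine ne_top_of_le_ne_top ?_ hle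
    rw [setLIntegral_const]
    exact ENNReal.mul_ne_top (ENNReal.rpow_ne_top_of_nonneg (by linarith) (by simp))
      (measure_spanningSets_lt_top ν n).ne

/-- Schur's test. -/
lemma eLpNorm_lintegral_mul_le {α β : Type*} [MeasurableSpace α] [MeasurableSpace β]
    {μ : Measure α} [SFinite μ] {ν : Measure β} [SFinite ν] {k : α → β → ℝ≥0∞}
    (hk : Measurable (Function.uncurry k)) {A : ℝ≥0∞} (hA : ∀ x, ∫⁻ z, k x z ∂ν ≤ A)
    (hB : ∀ z, ∫⁻ x, k x z ∂μ ≤ A) {h : β → ℝ≥0∞} (hh : Measurable h) {p : ℝ} (hp : 1 ≤ p) :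
    eLpNorm (fun x => ∫⁻ z, k x z * h z ∂ν) (ENNReal.ofReal p) μ ≤
      A * eLpNorm h (ENNReal.ofReal p) ν := by
  have hp0 : 0 < p := by linarith
  have hpne : ENNReal.ofReal p ≠ 0 := by simpa using hp0
  have hk1 : ∀ x, Measurable (k x) := fun z => hk.comp measurable_prodMk_left
  have hk2 : ∀ t, Measurable fun z => k z t := fun t => hk.comp measurable_prodMk_right
  have jensen : ∀ x, (∫⁻ z, k x z * h z ∂ν) ^ p ≤ A ^ (p - 1) * ∫⁻ z, k x z * h z ^ p ∂ν := by
    intro x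
    have h1 := eLpNorm_le_eLpNorm_mul_rpow_measure_univ (f := h) (μ := ν.withDensity (k x))
      (p := 1) (q := ENNReal.ofReal p) (by simpa using hp) hh.aestronglyMeasurable
    rw [eLpNorm_one_eq_lintegral_enorm, eLpNorm_eq_lintegral_rpow_enorm_toReal hpne (by simp),
      ENNReal.toReal_ofReal hp0.le, withDensity_apply _ MeasurableSet.univ,
      Measure.restrict_univ] at h1
    simp only [enorm_eq_self] at h1
    rw [lintegral_withDensity_eq_lintegral_mul _ (hk1 x) hh,
      lintegral_withDensity_eq_lintegral_mul _ (hk1 x) (hh.pow_const _)] at h1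
    simp only [Pi.mul_apply] at h1
    have h2 := ENNReal.rpow_le_rpow h1 hp0.le
    refine h2.trans ?_
    rw [ENNReal.mul_rpow_of_nonneg _ _ hp0.le, ← ENNReal.rpow_mul, ← ENNReal.rpow_mul,
      one_div_mul_cancel hp0.ne', ENNReal.rpow_one, mul_comm]
    have : (1 / (1 : ℝ≥0∞).toReal - 1 / p) * p = p - 1 := by
      rw [ENNReal.toReal_one]; field_simp
    rw [this]
    exact mul_le_mul' (ENNReal.rpow_le_rpow (hA x) (by linarith)) le_rfl
  rw [eLpNorm_eq_lintegral_rpow_enorm_toReal hpne (by simp),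
    eLpNorm_eq_lintegral_rpow_enorm_toReal hpne (by simp), ENNReal.toReal_ofReal hp0.le]
  simp only [enorm_eq_self]
  have hAp : A = (A ^ p) ^ (1 / p) := by
    rw [← ENNReal.rpow_mul, mul_one_div_cancel hp0.ne', ENNReal.rpow_one]
  conv_rhs => rw [hAp]
  rw [← ENNReal.mul_rpow_of_nonneg _ _ (by positivity)]
  refine ENNReal.rpow_le_rpow ?_ (by positivity)
  have hm : Measurable fun x : α × β => k x.1 x.2 * h x.2 ^ p :=
    hk.mul ((hh.comp measurable_snd).pow_const _)
  calc ∫⁻ x, (∫⁻ z, k x z * h z ∂ν) ^ p ∂μ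
      ≤ ∫⁻ x, A ^ (p - 1) * ∫⁻ z, k x z * h z ^ p ∂ν ∂μ := lintegral_mono jensen
    _ = A ^ (p - 1) * ∫⁻ x, ∫⁻ z, k x z * h z ^ p ∂ν ∂μ :=
        lintegral_const_mul _ hm.lintegral_prod_right'
    _ = A ^ (p - 1) * ∫⁻ z, (∫⁻ x, k x z ∂μ) * h z ^ p ∂ν := by
        rw [lintegral_lintegral_swap hm.aemeasurable]
        congr 1
        exact lintegral_congr fun z => lintegral_mul_const _ (hk2 z)
    _ ≤ A ^ (p - 1) * ∫⁻ z, A * h z ^ p ∂ν := by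
        gcongr with z
        exact hB z
    _ = A ^ p * ∫⁻ z, h z ^ p ∂ν := by
        rw [lintegral_const_mul _ (hh.pow_const _), ← mul_assoc]
        congr 1
        conv_lhs => rw [← ENNReal.rpow_one A, ← ENNReal.rpow_mul]
        rw [one_mul, ← ENNReal.rpow_add_of_nonneg _ _ (by linarith) (by norm_num)]
        congr 1; ring

/-- The scale-invariant measure `dt / t` on `(0, ρ)`. -/
def scaleMeasure (ρ : ℝ) : Measure ℝ :=
  (volume.restrict (Ioo 0 ρ)).withDensity fun t => ENNReal.ofReal t⁻¹

instance (ρ : ℝ) : SigmaFinite (scaleMeasure ρ) := SigmaFinite.withDensity_ofReal _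

lemma lintegral_scaleMeasure (ρ : ℝ) (φ : ℝ → ℝ≥0∞) :
    ∫⁻ t, φ t ∂scaleMeasure ρ = ∫⁻ t in Ioo 0 ρ, φ t * ENNReal.ofReal t⁻¹ := by
  rw [scaleMeasure, lintegral_withDensity_eq_lintegral_mul_non_measurable _ (by fun_prop)
    (Filter.Eventually.of_forall fun _ => by simp)]
  simp [mul_comm]

lemma ae_scaleMeasure (ρ : ℝ) : ae (scaleMeasure ρ) = ae (volume.restrict (Ioo 0 ρ)) := by
  refine le_antisymm (withDensity_absolutelyContinuous _ _).ae_le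
    (withDensity_absolutelyContinuous' (by fun_prop) ?_).ae_le
  filter_upwards [ae_restrict_mem measurableSet_Ioo] with t ht
  simpa using ht.1

lemma ae_scaleMeasure_mem (ρ : ℝ) : ∀ᵐ t ∂scaleMeasure ρ, t ∈ Ioo 0 ρ := by
  rw [ae_scaleMeasure]
  exact ae_restrict_mem measurableSet_Ioo

lemma eLpNorm_scaleMeasure (ρ : ℝ) {q : ℝ≥0∞} (hq : 1 ≤ q) (φ : ℝ → ℝ≥0∞) :
    eLpNorm φ q (scaleMeasure ρ) = if q = ⊤ then essSup φ (volume.restrict (Ioo 0 ρ)) else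
      (∫⁻ t in Ioo 0 ρ, φ t ^ q.toReal * ENNReal.ofReal t⁻¹) ^ (1 / q.toReal) := by
  split_ifs with h
  · subst h
    rw [eLpNorm_exponent_top, eLpNormEssSup, essSup, ae_scaleMeasure]
    rfl
  · rw [eLpNorm_eq_lintegral_rpow_enorm_toReal (zero_lt_one.trans_le hq).ne' h,
      lintegral_scaleMeasure]
    rfl

lemma map_mul_scaleMeasure {c : ℝ} (hc : 0 < c) (ρ : ℝ) :
    (scaleMeasure ρ).map (fun t => c * t) = scaleMeasure (c * ρ) := by
  ext s hs
  have hemb : MeasurableEmbedding fun t : ℝ => c * t := measurableEmbedding_mulLeft₀ hc.ne'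
  rw [hemb.map_apply, ← lintegral_indicator_one hs, ← lintegral_indicator_one (hemb.measurable hs),
    lintegral_scaleMeasure, lintegral_scaleMeasure, ← lintegral_indicator measurableSet_Ioo,
    ← lintegral_indicator measurableSet_Ioo]
  have hv : (volume : Measure ℝ) = ENNReal.ofReal c • Measure.map (c * ·) volume := by
    have := Real.smul_map_volume_mul_left hc.ne'
    rw [abs_of_pos hc] at this
    exact this.symm
  conv_rhs => rw [hv]
  rw [lintegral_smul_measure, hemb.lintegral_map, smul_eq_mul, ← lintegral_const_mul']
  · refine lintegral_congr fun t => ?_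
    have h1 : c * t ∈ Ioo 0 (c * ρ) ↔ t ∈ Ioo 0 ρ := by
      simp [mul_pos_iff_of_pos_left hc, mul_lt_mul_iff_right₀ hc]
    by_cases ht : t ∈ Ioo 0 ρ
    · rw [indicator_of_mem ht, indicator_of_mem (h1.2 ht)]
      by_cases hts : c * t ∈ s
      · rw [indicator_of_mem (show t ∈ (fun t => c * t) ⁻¹' s from hts), indicator_of_mem hts]
        simp only [Pi.one_apply, one_mul]
        rw [← ENNReal.ofReal_mul hc.le]
        congr 1
        field_simp
      · rw [indicator_of_notMem (show t ∉ (fun t => c * t) ⁻¹' s from hts),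
          indicator_of_notMem hts]
        simp
    · rw [indicator_of_notMem ht, indicator_of_notMem (fun h => ht (h1.1 h)), mul_zero]
  · simp

lemma eLpNorm_comp_mul_scaleMeasure {c : ℝ} (hc : 0 < c) (ρ : ℝ) (q : ℝ≥0∞) (φ : ℝ → ℝ≥0∞) :
    eLpNorm (fun t => φ (c * t)) q (scaleMeasure ρ) = eLpNorm φ q (scaleMeasure (c * ρ)) := by
  rw [← map_mul_scaleMeasure hc,
    (measurableEmbedding_mulLeft₀ hc.ne').eLpNorm_map_measure]
  rfl

lemma scaleMeasure_mono {ρ ρ' : ℝ} (h : ρ ≤ ρ') : scaleMeasure ρ ≤ scaleMeasure ρ' := by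
  refine Measure.le_iff.2 fun s hs => ?_
  rw [scaleMeasure, scaleMeasure, withDensity_apply _ hs, withDensity_apply _ hs]
  refine lintegral_mono' (Measure.restrict_mono le_rfl (Measure.restrict_mono ?_ le_rfl)) le_rfl
  exact Ioo_subset_Ioo_right h

lemma scaleMeasure_restrict {a ρ : ℝ} (h : a ≤ ρ) :
    (scaleMeasure ρ).restrict (Iio a) = scaleMeasure a := by
  have hI : Iio a ∩ Ioo 0 ρ = Ioo 0 a := by
    ext t
    exact ⟨fun ⟨h1, h2, _⟩ => ⟨h2, h1⟩, fun ⟨h1, h2⟩ => ⟨h2, h1, lt_of_lt_of_le h2 h⟩⟩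
  rw [scaleMeasure, scaleMeasure, restrict_withDensity measurableSet_Iio,
    Measure.restrict_restrict measurableSet_Iio, hI]

lemma eLpNorm_indicator_Iio_comp_mul_le {c a ρ R : ℝ} (hc : 0 < c) (haR : c * a ≤ R)
    {q : ℝ≥0∞} (φ : ℝ → ℝ≥0∞) :
    eLpNorm (fun t => (Iio a).indicator (fun t => φ (c * t)) t) q (scaleMeasure ρ) ≤
      eLpNorm φ q (scaleMeasure R) := by
  change eLpNorm ((Iio a).indicator (fun t => φ (c * t))) q (scaleMeasure ρ) ≤ _
  rw [eLpNorm_indicator_eq_eLpNorm_restrict measurableSet_Iio]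
  calc _ ≤ eLpNorm (fun t => φ (c * t)) q (scaleMeasure a) := by
        refine eLpNorm_mono_measure _ ?_
        rcases le_total a ρ with h | h
        · rw [scaleMeasure_restrict h]
        · exact Measure.restrict_le_self.trans (scaleMeasure_mono h)
    _ = eLpNorm φ q (scaleMeasure (c * a)) := eLpNorm_comp_mul_scaleMeasure hc _ _ _
    _ ≤ _ := eLpNorm_mono_measure _ (scaleMeasure_mono haR)

lemma lintegral_rpow_scaleMeasure {κ : ℝ} (hκ : 0 < κ) :
    ∫⁻ t, ENNReal.ofReal (t ^ κ) ∂scaleMeasure 1 = ENNReal.ofReal (1 / κ) := by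
  rw [lintegral_scaleMeasure]
  have h1 : ∀ t ∈ Ioo (0 : ℝ) 1, ENNReal.ofReal (t ^ κ) * ENNReal.ofReal t⁻¹ =
      ENNReal.ofReal (t ^ (κ - 1)) := by
    intro t ht
    rw [← ENNReal.ofReal_mul (Real.rpow_nonneg ht.1.le _), Real.rpow_sub_one ht.1.ne',
      div_eq_mul_inv]
  rw [setLIntegral_congr_fun measurableSet_Ioo h1]
  have h_int : IntegrableOn (fun t : ℝ => t ^ (κ - 1)) (Ioo 0 1) := by
    have := intervalIntegral.intervalIntegrable_rpow' (a := 0) (b := 1) (r := κ - 1) (by linarith)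
    rw [intervalIntegrable_iff_integrableOn_Ioo_of_le zero_le_one] at this
    exact this
  rw [← ofReal_integral_eq_lintegral_ofReal h_int]
  · congr 1
    rw [← integral_Ioc_eq_integral_Ioo, ← intervalIntegral.integral_of_le zero_le_one,
      integral_rpow (Or.inl (by linarith))]
    simp [hκ.ne']
  · filter_upwards [ae_restrict_mem measurableSet_Ioo] with t ht
    exact Real.rpow_nonneg ht.1.le _

lemma eLpNorm_rpow_scaleMeasure_le {κ : ℝ} (hκ : 0 < κ) {q : ℝ≥0∞} (hq : 1 ≤ q) :
    eLpNorm (fun t => ENNReal.ofReal (t ^ κ)) q (scaleMeasure 1) ≤ ENNReal.ofReal (1 + 1 / κ) := by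
  have hle : ∀ᵐ t ∂scaleMeasure 1, ENNReal.ofReal (t ^ κ) ≤ 1 := by
    filter_upwards [ae_scaleMeasure_mem 1] with t ht
    exact ENNReal.ofReal_le_one.2 (Real.rpow_le_one ht.1.le ht.2.le hκ.le)
  have h1 : (1 : ℝ≥0∞) ≤ ENNReal.ofReal (1 + 1 / κ) := by
    rw [← ENNReal.ofReal_one]; exact ENNReal.ofReal_le_ofReal (by simp [hκ.le])
  rcases eq_or_ne q ⊤ with rfl | hqt
  · rw [eLpNorm_exponent_top]
    exact (essSup_le_of_ae_le 1 (hle.mono fun t ht => by rwa [enorm_eq_self])).trans h1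
  have hq1 : 1 ≤ q.toReal := by
    rw [← ENNReal.toReal_one]; exact (ENNReal.toReal_le_toReal (by simp) hqt).2 hq
  rw [eLpNorm_eq_lintegral_rpow_enorm_toReal (zero_lt_one.trans_le hq).ne' hqt]
  have h2 : ∫⁻ t, ‖ENNReal.ofReal (t ^ κ)‖ₑ ^ q.toReal ∂scaleMeasure 1 ≤
      ENNReal.ofReal (1 + 1 / κ) := by
    calc _ ≤ ∫⁻ t, ENNReal.ofReal (t ^ κ) ∂scaleMeasure 1 := by
          refine lintegral_mono_ae ?_
          filter_upwards [hle] with t ht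
          rw [enorm_eq_self]
          exact (ENNReal.rpow_le_rpow_of_exponent_ge ht hq1).trans_eq (ENNReal.rpow_one _)
      _ = _ := lintegral_rpow_scaleMeasure hκ
      _ ≤ _ := ENNReal.ofReal_le_ofReal (by linarith)
  refine (ENNReal.rpow_le_rpow h2 (by positivity)).trans ?_
  refine (ENNReal.rpow_le_rpow_of_exponent_le h1 (z := 1) ?_).trans_eq (ENNReal.rpow_one _)
  rw [div_le_one (by linarith)]; exact hq1

lemma eLpNorm_indicator_rpow_scaleMeasure_le {κ : ℝ} (hκ : 0 < κ) {q : ℝ≥0∞} (hq : 1 ≤ q)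
    {a : ℝ} (ha : 0 < a) (ρ : ℝ) :
    eLpNorm (fun t => (Iio a).indicator (fun t => ENNReal.ofReal ((t / a) ^ κ)) t) q
      (scaleMeasure ρ) ≤ ENNReal.ofReal (1 + 1 / κ) := by
  refine le_trans ?_ (eLpNorm_rpow_scaleMeasure_le hκ hq)
  have := eLpNorm_indicator_Iio_comp_mul_le (c := a⁻¹) (a := a) (ρ := ρ) (R := 1) (q := q)
    (inv_pos.2 ha) (by rw [inv_mul_cancel₀ ha.ne']) (fun t => ENNReal.ofReal (t ^ κ))
  refine le_trans (le_of_eq ?_) this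
  simp only [div_eq_inv_mul]

lemma scaleMeasure_Ioo_ge {a R : ℝ} (ha : 0 < a) (haR : 2 * a ≤ R) :
    2⁻¹ ≤ scaleMeasure R (Ioo a (2 * a)) := by
  rw [← lintegral_indicator_one measurableSet_Ioo, lintegral_scaleMeasure,
    ← lintegral_indicator measurableSet_Ioo]
  calc (2⁻¹ : ℝ≥0∞) = ∫⁻ t in Ioo a (2 * a), ENNReal.ofReal (2 * a)⁻¹ := by
        rw [setLIntegral_const, Real.volume_Ioo, ← ENNReal.ofReal_mul (by positivity)]
        have : (2 * a)⁻¹ * (2 * a - a) = 2⁻¹ := by field_simp; ring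
        rw [this, ENNReal.ofReal_inv_of_pos (by norm_num)]
        simp
    _ ≤ _ := by
        rw [← lintegral_indicator measurableSet_Ioo]
        refine lintegral_mono fun t => ?_
        by_cases ht : t ∈ Ioo a (2 * a)
        · rw [indicator_of_mem ht, indicator_of_mem (show t ∈ Ioo 0 R from
            ⟨ha.trans ht.1, ht.2.trans_le haR⟩), indicator_of_mem ht, Pi.one_apply, one_mul]
          refine ENNReal.ofReal_le_ofReal ?_
          gcongr
          · exact ha.trans ht.1
          · exact ht.2.le
        · rw [indicator_of_notMem ht]; exact zero_le

lemma const_le_eLpNorm_scaleMeasure {a R : ℝ} (ha : 0 < a) (haR : 2 * a ≤ R) {q : ℝ≥0∞}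
    (hq : 1 ≤ q) {φ : ℝ → ℝ≥0∞} {c : ℝ≥0∞} (hc : ∀ t ∈ Ioo a (2 * a), c ≤ φ t) :
    c ≤ 2 * eLpNorm φ q (scaleMeasure R) := by
  have h1 : eLpNorm ((Ioo a (2 * a)).indicator fun _ => c) q (scaleMeasure R) ≤
      eLpNorm φ q (scaleMeasure R) := by
    refine eLpNorm_mono_enorm fun t => ?_
    simp only [enorm_eq_self]
    exact indicator_apply_le' (fun h => hc t h) (fun _ => zero_le)
  have hν := scaleMeasure_Ioo_ge ha haR
  rw [eLpNorm_indicator_const' measurableSet_Ioo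
    ((by simp : (0 : ℝ≥0∞) < 2⁻¹).trans_le hν).ne' (zero_lt_one.trans_le hq).ne',
    enorm_eq_self] at h1
  have h2 : (2⁻¹ : ℝ≥0∞) ≤ (scaleMeasure R (Ioo a (2 * a))) ^ (1 / q.toReal) := by
    refine le_trans ?_ (ENNReal.rpow_le_rpow hν (by positivity))
    conv_lhs => rw [← ENNReal.rpow_one 2⁻¹]
    refine ENNReal.rpow_le_rpow_of_exponent_ge (by simp) ?_
    rcases eq_or_ne q ⊤ with rfl | hqt
    · simp
    · have hq1 : 1 ≤ q.toReal := by
        rw [← ENNReal.toReal_one]; exact (ENNReal.toReal_le_toReal (by simp) hqt).2 hq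
      rw [div_le_one (by linarith)]; exact hq1
  calc c = 2 * (c * 2⁻¹) := by
        rw [mul_comm c, ← mul_assoc, ENNReal.mul_inv_cancel (by simp) (by simp), one_mul]
    _ ≤ 2 * (c * (scaleMeasure R (Ioo a (2 * a))) ^ (1 / q.toReal)) := by gcongr
    _ ≤ _ := by gcongr

/-- The integral of `‖f x - f y‖` over `y ∈ B(x,t) ∩ U`. -/
def localOsc {d : ℕ} (U : Set (EuclideanSpace ℝ (Fin d))) (f : EuclideanSpace ℝ (Fin d) → ℝ)
    (x : EuclideanSpace ℝ (Fin d)) (t : ℝ) : ℝ≥0∞ :=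
  ∫⁻ y in Metric.ball x t ∩ U, ‖f x - f y‖ₑ

lemma localOsc_mono {d : ℕ} (U : Set (EuclideanSpace ℝ (Fin d)))
    (f : EuclideanSpace ℝ (Fin d) → ℝ) (x : EuclideanSpace ℝ (Fin d)) :
    Monotone (localOsc U f x) := fun _ _ h =>
  lintegral_mono_set (inter_subset_inter_left _ (Metric.ball_subset_ball h))

lemma triebelInner_one {d : ℕ} (U : Set (EuclideanSpace ℝ (Fin d)))
    (f : EuclideanSpace ℝ (Fin d) → ℝ) (σ : ℝ) (x : EuclideanSpace ℝ (Fin d)) (t : ℝ) :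
    triebelInner d U f σ 1 x t = ENNReal.ofReal (t ^ (-(σ + d))) * localOsc U f x t := by
  simp [triebelInner, localOsc, Real.enorm_eq_ofReal_abs]

lemma measurable_localOsc {d : ℕ} {U : Set (EuclideanSpace ℝ (Fin d))} (hU : MeasurableSet U)
    {f : EuclideanSpace ℝ (Fin d) → ℝ} (hf : Measurable f) :
    Measurable (Function.uncurry (localOsc U f)) := by
  have h : Function.uncurry (localOsc U f) = fun p : EuclideanSpace ℝ (Fin d) × ℝ =>
      ∫⁻ y, {a : (EuclideanSpace ℝ (Fin d) × ℝ) × EuclideanSpace ℝ (Fin d) |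
        dist a.2 a.1.1 < a.1.2 ∧ a.2 ∈ U}.indicator (fun a => ‖f a.1.1 - f a.2‖ₑ) (p, y) := by
    ext ⟨x, t⟩
    simp only [Function.uncurry, localOsc]
    rw [← lintegral_indicator (Metric.isOpen_ball.measurableSet.inter hU)]
    rfl
  rw [h]
  refine Measurable.lintegral_prod_right' (Measurable.indicator (by fun_prop) ?_)
  refine MeasurableSet.inter ?_ (measurable_snd hU)
  exact measurableSet_lt (measurable_snd.dist (measurable_fst.comp measurable_fst))
    (measurable_snd.comp measurable_fst)

lemma measurable_triebelInner_one {d : ℕ} {U : Set (EuclideanSpace ℝ (Fin d))}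
    (hU : MeasurableSet U) {f : EuclideanSpace ℝ (Fin d) → ℝ} (hf : Measurable f) (σ : ℝ) :
    Measurable (Function.uncurry fun x t => triebelInner d U f σ 1 x t) := by
  simp only [triebelInner_one]
  exact Measurable.mul (by fun_prop) (measurable_localOsc hU hf)

/-- `E` is an average of `f` over parts of `Ω` near `x`, at the scale of the distance to `Ω`,
with averaging weights `w x`. -/
structure IsAveraging {d : ℕ} (r : ℝ) (K : NNReal) (Ω : Set (EuclideanSpace ℝ (Fin d)))
    (f E : EuclideanSpace ℝ (Fin d) → ℝ)
    (w : EuclideanSpace ℝ (Fin d) → EuclideanSpace ℝ (Fin d) → ℝ≥0∞) : Prop where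
  measurable_weight : Measurable (Function.uncurry w)
  measurable_avg : Measurable E
  mass_le : ∀ x, ∫⁻ z, w x z ≤ 1
  comass_le : ∀ z, ∫⁻ x, w x z ≤ K
  supp : ∀ x z, w x z ≠ 0 → z ∈ Ω ∧ dist x z < 4 * Metric.infDist x Ω
  dev_le : ∀ x, 0 < Metric.infDist x Ω → Metric.infDist x Ω ≤ r → ∀ c : ℝ,
    ‖E x - c‖ₑ ≤ ∫⁻ z, w x z * ‖f z - c‖ₑ
  lip : ∀ x y, 0 < Metric.infDist x Ω → Metric.infDist x Ω ≤ r → 0 < Metric.infDist y Ω →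
    Metric.infDist y Ω ≤ r → dist x y ≤ Metric.infDist x Ω / 2 →
    ‖E x - E y‖ₑ ≤ K * ENNReal.ofReal (dist x y / Metric.infDist x Ω ^ (d + 1)) *
      ∫⁻ z in Metric.ball x (8 * Metric.infDist x Ω) ∩ Ω, ‖f z - E x‖ₑ

/-- A Lipschitz cutoff equal to one near `Ω` and supported at distance at most `r / 2`. -/
def collarCutoff {d : ℕ} (r : ℝ) (Ω : Set (EuclideanSpace ℝ (Fin d)))
    (x : EuclideanSpace ℝ (Fin d)) : ℝ :=
  max 0 (min 1 (2 - 4 * Metric.infDist x Ω / r))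

open Classical in
/-- The extension of `f` from `Ω` by the truncated averages `E`. -/
def collarExtension {d : ℕ} (r : ℝ) (Ω : Set (EuclideanSpace ℝ (Fin d)))
    (f E : EuclideanSpace ℝ (Fin d) → ℝ) : EuclideanSpace ℝ (Fin d) → ℝ :=
  Ω.piecewise f fun x => collarCutoff r Ω x * E x

section Collar

variable {d : ℕ} {r : ℝ} {Ω : Set (EuclideanSpace ℝ (Fin d))}
  {f E : EuclideanSpace ℝ (Fin d) → ℝ} {x y : EuclideanSpace ℝ (Fin d)}

lemma collarExtension_of_mem (h : x ∈ Ω) : collarExtension r Ω f E x = f x := by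
  classical
  exact piecewise_eq_of_mem _ _ _ h

lemma collarExtension_of_pos (h : 0 < Metric.infDist x Ω) :
    collarExtension r Ω f E x = collarCutoff r Ω x * E x := by
  classical
  exact piecewise_eq_of_notMem _ _ _ fun hx => h.ne' (Metric.infDist_zero_of_mem hx)

lemma collarCutoff_eq_one (hr : 0 < r) (h : Metric.infDist x Ω ≤ r / 4) :
    collarCutoff r Ω x = 1 := by
  have : 4 * Metric.infDist x Ω / r ≤ 1 := by rw [div_le_one hr]; linarith
  rw [collarCutoff, min_eq_left (by linarith), max_eq_right zero_le_one]

lemma collarCutoff_eq_zero (hr : 0 < r) (h : r / 2 ≤ Metric.infDist x Ω) :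
    collarCutoff r Ω x = 0 := by
  have : 2 ≤ 4 * Metric.infDist x Ω / r := by rw [le_div_iff₀ hr]; linarith
  rw [collarCutoff, max_eq_left]
  exact (min_le_right _ _).trans (by linarith)

lemma collarCutoff_nonneg : 0 ≤ collarCutoff r Ω x := le_max_left _ _

lemma collarCutoff_le_one : collarCutoff r Ω x ≤ 1 := max_le zero_le_one (min_le_left _ _)

lemma abs_infDist_sub_le : |Metric.infDist x Ω - Metric.infDist y Ω| ≤ dist x y := by
  rw [← Real.dist_eq]
  simpa using (Metric.lipschitz_infDist_pt Ω).dist_le_mul x y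

lemma abs_collarCutoff_sub_le (hr : 0 < r) :
    |collarCutoff r Ω x - collarCutoff r Ω y| ≤ 4 / r * dist x y := by
  refine (abs_max_sub_max_le_max _ _ _ _).trans (max_le (by simp; positivity) ?_)
  refine (abs_min_sub_min_le_max _ _ _ _).trans (max_le (by simp; positivity) ?_)
  have : 2 - 4 * Metric.infDist x Ω / r - (2 - 4 * Metric.infDist y Ω / r) =
      4 / r * (Metric.infDist y Ω - Metric.infDist x Ω) := by ring
  rw [this, abs_mul, abs_of_pos (by positivity : 0 < 4 / r), dist_comm]
  gcongr
  exact abs_infDist_sub_le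

lemma measurable_collarExtension (hΩ : MeasurableSet Ω) (hf : Measurable f) (hE : Measurable E) :
    Measurable (collarExtension r Ω f E) := by
  classical
  refine Measurable.piecewise hΩ hf (Measurable.mul ?_ hE)
  unfold collarCutoff
  have : Measurable fun x => Metric.infDist x Ω := measurable_infDist
  fun_prop

end Collar

namespace IsAveraging

variable {d : ℕ} {r : ℝ} {K : NNReal} {Ω : Set (EuclideanSpace ℝ (Fin d))}
  {f E : EuclideanSpace ℝ (Fin d) → ℝ}
  {w : EuclideanSpace ℝ (Fin d) → EuclideanSpace ℝ (Fin d) → ℝ≥0∞}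
  {x : EuclideanSpace ℝ (Fin d)} {t : ℝ}

lemma lintegral_le (H : IsAveraging r K Ω f E w) {h : EuclideanSpace ℝ (Fin d) → ℝ≥0∞}
    (hh : Measurable h) : ∫⁻ x, ∫⁻ z, w x z * h z ≤ K * ∫⁻ z, h z := by
  have hm : Measurable fun x : EuclideanSpace ℝ (Fin d) × EuclideanSpace ℝ (Fin d) =>
      w x.1 x.2 * h x.2 := H.measurable_weight.mul (hh.comp measurable_snd)
  rw [lintegral_lintegral_swap hm.aemeasurable, ← lintegral_const_mul _ hh]
  refine lintegral_mono fun z => ?_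
  have hw : Measurable fun x => w x z := H.measurable_weight.of_uncurry_right
  rw [lintegral_mul_const _ hw]
  gcongr
  exact H.comass_le z

lemma localOsc_le_of_mem (H : IsAveraging r K Ω f E w) (hr : 0 < r) (hΩ : MeasurableSet Ω)
    (hnull : ∀ᵐ x, x ∈ Ω ∨ 0 < Metric.infDist x Ω) (hf : Measurable f) (hx : x ∈ Ω)
    (ht : t ≤ r / 4) :
    localOsc univ (collarExtension r Ω f E) x t ≤ (1 + K) * localOsc Ω f x (5 * t) := by
  rcases le_or_gt t 0 with ht0 | ht0
  · simp [localOsc, Metric.ball_eq_empty.2 ht0]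
  set F := collarExtension r Ω f E
  have hB : MeasurableSet (Metric.ball x (5 * t) ∩ Ω) := Metric.isOpen_ball.measurableSet.inter hΩ
  set h : EuclideanSpace ℝ (Fin d) → ℝ≥0∞ :=
    (Metric.ball x (5 * t) ∩ Ω).indicator fun z => ‖f x - f z‖ₑ with hh
  have hhm : Measurable h := Measurable.indicator (by fun_prop) hB
  have h_int : ∫⁻ z, h z = localOsc Ω f x (5 * t) := lintegral_indicator hB _
  rw [localOsc, inter_univ, ← lintegral_indicator Metric.isOpen_ball.measurableSet, one_add_mul,
    ← h_int]
  refine le_trans ?_ (add_le_add_right (H.lintegral_le hhm) _)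
  rw [← lintegral_add_left hhm]
  refine lintegral_mono_ae ?_
  filter_upwards [hnull] with y hy
  refine indicator_apply_le' (fun hyt => ?_) (fun _ => zero_le)
  rw [Metric.mem_ball] at hyt
  have hFx : F x = f x := collarExtension_of_mem hx
  rcases hy with hy | hy
  · have hFy : F y = f y := collarExtension_of_mem hy
    have : h y = ‖f x - f y‖ₑ := by
      rw [hh, indicator_of_mem]
      exact ⟨by rw [Metric.mem_ball]; linarith, hy⟩
    rw [hFx, hFy, this]
    exact le_self_add
  · have hyd : Metric.infDist y Ω < t := (Metric.infDist_le_dist_of_mem hx).trans_lt hyt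
    have hFy : F y = E y := by
      rw [show F y = _ from collarExtension_of_pos hy, collarCutoff_eq_one hr (by linarith),
        one_mul]
    rw [hFx, hFy, enorm_sub_rev]
    refine (H.dev_le y hy (by linarith) (f x)).trans (le_trans (lintegral_mono fun z => ?_)
      le_add_self)
    rcases eq_or_ne (w y z) 0 with h0 | h0
    · simp [h0]
    · obtain ⟨hz, hyz⟩ := H.supp y z h0
      gcongr
      rw [hh, indicator_of_mem, enorm_sub_rev]
      refine ⟨?_, hz⟩
      rw [Metric.mem_ball]
      linarith [dist_triangle z y x, dist_comm z y]

lemma localOsc_le_lintegral (H : IsAveraging r K Ω f E w) (hr : 0 < r) (hΩ : MeasurableSet Ω)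
    (hnull : ∀ᵐ x, x ∈ Ω ∨ 0 < Metric.infDist x Ω) (hf : Measurable f)
    (hx : 0 < Metric.infDist x Ω) (hxt : Metric.infDist x Ω ≤ t) (ht : 5 * t ≤ r / 4) :
    localOsc univ (collarExtension r Ω f E) x t ≤
      (1 + K) * ∫⁻ z, w x z * localOsc Ω f z (25 * t) := by
  have hFm : Measurable (collarExtension r Ω f E) :=
    measurable_collarExtension hΩ hf H.measurable_avg
  have hwm : Measurable (w x) := H.measurable_weight.of_uncurry_left
  have hJm : Measurable fun z => localOsc Ω f z (25 * t) :=
    (measurable_localOsc hΩ hf).of_uncurry_right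
  set F := collarExtension r Ω f E
  have hFx : F x = E x := by
    rw [show F x = _ from collarExtension_of_pos hx, collarCutoff_eq_one hr (by linarith), one_mul]
  rw [localOsc, inter_univ, hFx]
  calc ∫⁻ y in Metric.ball x t, ‖E x - F y‖ₑ
      ≤ ∫⁻ y in Metric.ball x t, ∫⁻ z, w x z * ‖f z - F y‖ₑ :=
        lintegral_mono fun y => H.dev_le x hx (by linarith) _
    _ = ∫⁻ z, ∫⁻ y in Metric.ball x t, w x z * ‖f z - F y‖ₑ := by
        refine lintegral_lintegral_swap (f := fun y z => w x z * ‖f z - F y‖ₑ) ?_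
        refine Measurable.aemeasurable ?_
        exact (hwm.comp measurable_snd).mul
          ((hf.comp measurable_snd).sub (hFm.comp measurable_fst)).enorm
    _ = ∫⁻ z, w x z * ∫⁻ y in Metric.ball x t, ‖f z - F y‖ₑ := by
        refine lintegral_congr fun z => ?_
        rw [lintegral_const_mul _ (by fun_prop)]
    _ ≤ ∫⁻ z, (1 + K) * (w x z * localOsc Ω f z (25 * t)) := by
        refine lintegral_mono fun z => ?_
        rcases eq_or_ne (w x z) 0 with h0 | h0
        · simp [h0]
        obtain ⟨hz, hxz⟩ := H.supp x z h0
        rw [mul_left_comm]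
        gcongr
        have hFz : F z = f z := collarExtension_of_mem hz
        have h1 : localOsc univ F z (5 * t) ≤ (1 + K) * localOsc Ω f z (5 * (5 * t)) :=
          H.localOsc_le_of_mem hr hΩ hnull hf hz ht
        rw [show 5 * (5 * t) = 25 * t by ring] at h1
        refine le_trans ?_ h1
        rw [localOsc, inter_univ, hFz]
        refine lintegral_mono_set fun y hy => ?_
        rw [Metric.mem_ball] at hy ⊢
        linarith [dist_triangle y x z]
    _ = _ := lintegral_const_mul _ (hwm.mul hJm)

lemma setLIntegral_ball_const (x : EuclideanSpace ℝ (Fin d)) (ht : 0 < t) (c : ℝ≥0∞) :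
    ∫⁻ _ in Metric.ball x t, c =
      c * (ENNReal.ofReal (t ^ d) * volume (Metric.ball (0 : EuclideanSpace ℝ (Fin d)) 1)) := by
  rw [setLIntegral_const, Measure.addHaar_ball_of_pos _ _ ht]
  simp

lemma localOsc_le_small (H : IsAveraging r K Ω f E w) (hr : 0 < r) (hΩ : MeasurableSet Ω)
    (hx : 0 < Metric.infDist x Ω) (hxr : Metric.infDist x Ω ≤ r / 8) (ht0 : 0 < t)
    (ht : t ≤ Metric.infDist x Ω / 2) :
    localOsc univ (collarExtension r Ω f E) x t ≤
      K * volume (Metric.ball (0 : EuclideanSpace ℝ (Fin d)) 1) *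
        ENNReal.ofReal ((t / Metric.infDist x Ω) ^ (d + 1)) *
        localOsc univ (collarExtension r Ω f E) x (8 * Metric.infDist x Ω) := by
  set F := collarExtension r Ω f E
  set δ := Metric.infDist x Ω
  have hF : ∀ y, 0 < Metric.infDist y Ω → Metric.infDist y Ω ≤ r / 4 →
      F y = E y := fun y h1 h2 => by
    rw [show F y = _ from collarExtension_of_pos h1, collarCutoff_eq_one hr h2, one_mul]
  have hFx : F x = E x := hF x hx (by linarith)
  have hI : ∫⁻ z in Metric.ball x (8 * δ) ∩ Ω, ‖f z - E x‖ₑ ≤ localOsc univ F x (8 * δ) := by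
    rw [localOsc, inter_univ]
    refine le_trans (b := ∫⁻ z in Metric.ball x (8 * δ) ∩ Ω, ‖F x - F z‖ₑ) (le_of_eq ?_)
      (lintegral_mono_set inter_subset_left)
    refine setLIntegral_congr_fun (Metric.isOpen_ball.measurableSet.inter hΩ) fun z hz => ?_
    simp only [show F z = f z from collarExtension_of_mem hz.2, hFx]
    exact enorm_sub_rev _ _
  have hpt : ∀ y ∈ Metric.ball x t,
      ‖F x - F y‖ₑ ≤ K * ENNReal.ofReal (t / δ ^ (d + 1)) * localOsc univ F x (8 * δ) := by
    intro y hy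
    rw [Metric.mem_ball, dist_comm] at hy
    have h1 := abs_le.1 (abs_infDist_sub_le (x := x) (y := y) (Ω := Ω))
    have hy0 : 0 < Metric.infDist y Ω := by linarith
    have hy1 : Metric.infDist y Ω ≤ r / 4 := by linarith
    rw [hFx, hF y hy0 hy1]
    refine (H.lip x y hx (by linarith) hy0 (by linarith) (by linarith)).trans ?_
    gcongr
  rw [localOsc, inter_univ]
  refine (setLIntegral_mono' Metric.isOpen_ball.measurableSet hpt).trans (le_of_eq ?_)
  rw [setLIntegral_ball_const x ht0]
  have : ENNReal.ofReal ((t / δ) ^ (d + 1)) =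
      ENNReal.ofReal (t / δ ^ (d + 1)) * ENNReal.ofReal (t ^ d) := by
    rw [← ENNReal.ofReal_mul (by positivity)]
    congr 1
    rw [div_pow, div_mul_eq_mul_div, pow_succ', mul_comm]
  rw [this]
  ring

lemma localOsc_le_far (H : IsAveraging r K Ω f E w) (hr : 0 < r)
    {η : ℝ} (hη : 0 < η) (hx : η ≤ Metric.infDist x Ω) (hf : Measurable f) (ht0 : 0 < t)
    (ht : t ≤ η / 2) (htr : t ≤ r / 4) :
    localOsc univ (collarExtension r Ω f E) x t ≤
      (K * ENNReal.ofReal (1 / η ^ (d + 1)) * (1 + ENNReal.ofReal ((8 * r) ^ d) *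
          volume (Metric.ball (0 : EuclideanSpace ℝ (Fin d)) 1)) + ENNReal.ofReal (4 / r)) *
        volume (Metric.ball (0 : EuclideanSpace ℝ (Fin d)) 1) * ENNReal.ofReal (t ^ (d + 1)) *
        ((∫⁻ z in Metric.ball x (8 * r) ∩ Ω, ‖f z‖ₑ) + ∫⁻ z, w x z * ‖f z‖ₑ) := by
  set F := collarExtension r Ω f E
  set δ := Metric.infDist x Ω
  set V := volume (Metric.ball (0 : EuclideanSpace ℝ (Fin d)) 1)
  set M1 := ∫⁻ z in Metric.ball x (8 * r) ∩ Ω, ‖f z‖ₑ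
  set M2 := ∫⁻ z, w x z * ‖f z‖ₑ
  have hx0 : 0 < δ := hη.trans_le hx
  have hlow : ∀ y ∈ Metric.ball x t, |δ - Metric.infDist y Ω| < t := fun y hy => by
    rw [Metric.mem_ball, dist_comm] at hy
    exact abs_infDist_sub_le.trans_lt hy
  have hFx : F x = collarCutoff r Ω x * E x := collarExtension_of_pos hx0
  have hpt : ∀ y ∈ Metric.ball x t,
      ‖F x - F y‖ₑ ≤ ENNReal.ofReal t * ((K * ENNReal.ofReal (1 / η ^ (d + 1)) *
        (1 + ENNReal.ofReal ((8 * r) ^ d) * V) + ENNReal.ofReal (4 / r)) * (M1 + M2)) := by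
    intro y hy
    have h1 := abs_lt.1 (hlow y hy)
    rw [Metric.mem_ball, dist_comm] at hy
    have hy0 : 0 < Metric.infDist y Ω := by linarith
    have hFy : F y = collarCutoff r Ω y * E y := collarExtension_of_pos hy0
    rcases le_or_gt (3 * r / 4) δ with h3 | h3
    · rw [hFx, hFy, collarCutoff_eq_zero hr (by linarith : r / 2 ≤ δ),
        collarCutoff_eq_zero hr (by linarith : r / 2 ≤ Metric.infDist y Ω)]
      simp
    · have hE : ‖E x‖ₑ ≤ M2 := by simpa using H.dev_le x hx0 (by linarith) 0
      have hlip := H.lip x y hx0 (by linarith) hy0 (by linarith) (by linarith)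
      have hI : ∫⁻ z in Metric.ball x (8 * δ) ∩ Ω, ‖f z - E x‖ₑ ≤
          M1 + ENNReal.ofReal ((8 * r) ^ d) * V * M2 := by
        calc ∫⁻ z in Metric.ball x (8 * δ) ∩ Ω, ‖f z - E x‖ₑ
            ≤ ∫⁻ z in Metric.ball x (8 * r) ∩ Ω, ‖f z - E x‖ₑ :=
              lintegral_mono_set (inter_subset_inter_left _
                (Metric.ball_subset_ball (by linarith)))
          _ ≤ ∫⁻ z in Metric.ball x (8 * r) ∩ Ω, (‖f z‖ₑ + ‖E x‖ₑ) :=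
              lintegral_mono fun z => enorm_sub_le
          _ = M1 + ∫⁻ z in Metric.ball x (8 * r) ∩ Ω, ‖E x‖ₑ :=
              lintegral_add_left hf.enorm _
          _ ≤ M1 + ∫⁻ z in Metric.ball x (8 * r), M2 := by
              refine add_le_add le_rfl ?_
              exact (lintegral_mono_set inter_subset_left).trans (lintegral_mono fun _ => hE)
          _ = _ := by
              rw [setLIntegral_ball_const x (by positivity)]
              ring
      have hdec : F x - F y = collarCutoff r Ω y * (E x - E y) +
          (collarCutoff r Ω x - collarCutoff r Ω y) * E x := by rw [hFx, hFy]; ring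
      have hc1 : ‖collarCutoff r Ω y‖ₑ ≤ 1 := by
        rw [Real.enorm_eq_ofReal collarCutoff_nonneg]
        exact ENNReal.ofReal_le_one.2 collarCutoff_le_one
      have hc2 : ‖collarCutoff r Ω x - collarCutoff r Ω y‖ₑ ≤
          ENNReal.ofReal t * ENNReal.ofReal (4 / r) := by
        rw [Real.enorm_eq_ofReal_abs, ← ENNReal.ofReal_mul ht0.le]
        refine ENNReal.ofReal_le_ofReal ((abs_collarCutoff_sub_le hr).trans ?_)
        rw [mul_comm]
        gcongr
      have hc3 : ENNReal.ofReal (dist x y / δ ^ (d + 1)) ≤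
          ENNReal.ofReal t * ENNReal.ofReal (1 / η ^ (d + 1)) := by
        rw [← ENNReal.ofReal_mul ht0.le, mul_one_div]
        gcongr
      calc ‖F x - F y‖ₑ ≤ ‖collarCutoff r Ω y‖ₑ * ‖E x - E y‖ₑ +
            ‖collarCutoff r Ω x - collarCutoff r Ω y‖ₑ * ‖E x‖ₑ := by
            rw [hdec, ← enorm_mul, ← enorm_mul]
            exact enorm_add_le _ _
        _ ≤ 1 * (K * (ENNReal.ofReal t * ENNReal.ofReal (1 / η ^ (d + 1))) *
            (M1 + ENNReal.ofReal ((8 * r) ^ d) * V * M2)) +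
            ENNReal.ofReal t * ENNReal.ofReal (4 / r) * M2 := by
            gcongr
            refine hlip.trans ?_
            gcongr
        _ ≤ 1 * (K * (ENNReal.ofReal t * ENNReal.ofReal (1 / η ^ (d + 1))) *
            ((M1 + M2) + ENNReal.ofReal ((8 * r) ^ d) * V * (M1 + M2))) +
            ENNReal.ofReal t * ENNReal.ofReal (4 / r) * (M1 + M2) := by
            gcongr
            · exact le_self_add
            · exact le_add_self
            · exact le_add_self
        _ = _ := by ring
  rw [localOsc, inter_univ]
  refine (setLIntegral_mono' Metric.isOpen_ball.measurableSet hpt).trans (le_of_eq ?_)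
  rw [setLIntegral_ball_const x ht0, pow_succ t d, ENNReal.ofReal_mul (by positivity)]
  ring

end IsAveraging

lemma localOsc_univ_le {d : ℕ} {F : EuclideanSpace ℝ (Fin d) → ℝ}
    (x : EuclideanSpace ℝ (Fin d)) {t : ℝ} (ht : t ≤ 1) :
    localOsc univ F x t ≤
      volume (Metric.ball (0 : EuclideanSpace ℝ (Fin d)) 1) * ‖F x‖ₑ +
        ∫⁻ y in Metric.ball x 1, ‖F y‖ₑ := by
  refine (localOsc_mono univ F x ht).trans ?_
  rw [localOsc, inter_univ]
  calc ∫⁻ y in Metric.ball x 1, ‖F x - F y‖ₑ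
      ≤ ∫⁻ y in Metric.ball x 1, (‖F x‖ₑ + ‖F y‖ₑ) := lintegral_mono fun _ => enorm_sub_le
    _ = _ := by
        rw [lintegral_add_left measurable_const, setLIntegral_const,
          Measure.addHaar_ball_center, mul_comm]

lemma rpow_mul_localOsc {d : ℕ} (U : Set (EuclideanSpace ℝ (Fin d)))
    (f : EuclideanSpace ℝ (Fin d) → ℝ) (σ : ℝ) (x : EuclideanSpace ℝ (Fin d)) {c t : ℝ}
    (hc : 0 < c) (ht : 0 < t) :
    ENNReal.ofReal (t ^ (-(σ + d))) * localOsc U f x (c * t) =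
      ENNReal.ofReal (c ^ (σ + d)) * triebelInner d U f σ 1 x (c * t) := by
  rw [triebelInner_one, ← mul_assoc, ← ENNReal.ofReal_mul (by positivity)]
  congr 2
  rw [Real.mul_rpow hc.le ht.le, ← mul_assoc, ← Real.rpow_add hc]
  simp

lemma localOsc_le_eLpNorm_triebelInner {d : ℕ} (U : Set (EuclideanSpace ℝ (Fin d)))
    (f : EuclideanSpace ℝ (Fin d) → ℝ) {σ : ℝ} (hσ : 0 < σ) (x : EuclideanSpace ℝ (Fin d))
    {a R : ℝ} (ha : 0 < a) (haR : 2 * a ≤ R) {q : ℝ≥0∞} (hq : 1 ≤ q) :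
    ENNReal.ofReal ((2 * a) ^ (-(σ + d))) * localOsc U f x a ≤
      2 * eLpNorm (triebelInner d U f σ 1 x) q (scaleMeasure R) := by
  refine const_le_eLpNorm_scaleMeasure ha haR hq fun t ht => ?_
  rw [triebelInner_one]
  refine mul_le_mul' (ENNReal.ofReal_le_ofReal ?_) (localOsc_mono U f x ht.1.le)
  refine Real.rpow_le_rpow_of_nonpos (ha.trans ht.1) ht.2.le ?_
  have : (0 : ℝ) ≤ d := by positivity
  linarith

namespace IsAveraging

variable {d : ℕ} {r : ℝ} {K : NNReal} {Ω : Set (EuclideanSpace ℝ (Fin d))}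
  {f E : EuclideanSpace ℝ (Fin d) → ℝ}
  {w : EuclideanSpace ℝ (Fin d) → EuclideanSpace ℝ (Fin d) → ℝ≥0∞}
  {x : EuclideanSpace ℝ (Fin d)} {s t : ℝ} {q : ℝ≥0∞}

lemma triebelInner_le_of_mem (H : IsAveraging r K Ω f E w) (hr : 0 < r) (hΩ : MeasurableSet Ω)
    (hnull : ∀ᵐ x, x ∈ Ω ∨ 0 < Metric.infDist x Ω) (hf : Measurable f) (hx : x ∈ Ω)
    (ht0 : 0 < t) (ht : t ≤ r / 4) :
    triebelInner d univ (collarExtension r Ω f E) s 1 x t ≤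
      (1 + K) * ENNReal.ofReal (5 ^ (s + d)) * triebelInner d Ω f s 1 x (5 * t) := by
  rw [triebelInner_one, mul_assoc, ← rpow_mul_localOsc Ω f s x (by norm_num) ht0, mul_left_comm]
  gcongr
  exact H.localOsc_le_of_mem hr hΩ hnull hf hx ht

lemma triebelInner_le_lintegral (H : IsAveraging r K Ω f E w) (hr : 0 < r)
    (hΩ : MeasurableSet Ω) (hnull : ∀ᵐ x, x ∈ Ω ∨ 0 < Metric.infDist x Ω) (hf : Measurable f)
    (hx : 0 < Metric.infDist x Ω) (hxt : Metric.infDist x Ω ≤ t) (ht : 5 * t ≤ r / 4) :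
    triebelInner d univ (collarExtension r Ω f E) s 1 x t ≤
      (1 + K) * ENNReal.ofReal (25 ^ (s + d)) *
        ∫⁻ z, w x z * triebelInner d Ω f s 1 z (25 * t) := by
  have hwm : Measurable (w x) := H.measurable_weight.of_uncurry_left
  have hJm : Measurable fun z => w x z * localOsc Ω f z (25 * t) :=
    hwm.mul (measurable_localOsc hΩ hf).of_uncurry_right
  have hGm : Measurable fun z => w x z * triebelInner d Ω f s 1 z (25 * t) :=
    hwm.mul (measurable_triebelInner_one hΩ hf s).of_uncurry_right
  rw [triebelInner_one, mul_assoc, ← lintegral_const_mul _ hGm]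
  simp_rw [mul_left_comm (ENNReal.ofReal (25 ^ (s + d))),
    ← rpow_mul_localOsc Ω f s _ (by norm_num : (0 : ℝ) < 25) (hx.trans_le hxt),
    mul_left_comm _ (ENNReal.ofReal (t ^ (-(s + d))))]
  rw [lintegral_const_mul _ hJm, mul_left_comm]
  gcongr
  exact H.localOsc_le_lintegral hr hΩ hnull hf hx hxt ht

lemma localOsc_le_near (H : IsAveraging r K Ω f E w) (hr : 0 < r)
    (hΩ : MeasurableSet Ω) (hnull : ∀ᵐ x, x ∈ Ω ∨ 0 < Metric.infDist x Ω) (hf : Measurable f)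
    (hx : 0 < Metric.infDist x Ω) (hxr : Metric.infDist x Ω ≤ r / 160) (ht0 : 0 < t)
    (ht : t < 8 * Metric.infDist x Ω) :
    localOsc univ (collarExtension r Ω f E) x t ≤
      (K * volume (Metric.ball (0 : EuclideanSpace ℝ (Fin d)) 1) + ENNReal.ofReal (2 ^ (d + 1))) *
        (1 + K) * ENNReal.ofReal ((t / Metric.infDist x Ω) ^ (d + 1)) *
        ∫⁻ z, w x z * localOsc Ω f z (2 * (100 * Metric.infDist x Ω)) := by
  have h1 := H.localOsc_le_lintegral hr hΩ hnull hf hx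
    (by linarith : Metric.infDist x Ω ≤ 8 * Metric.infDist x Ω) (by linarith)
  rw [show 25 * (8 * Metric.infDist x Ω) = 2 * (100 * Metric.infDist x Ω) by ring] at h1
  set F := collarExtension r Ω f E
  set δ := Metric.infDist x Ω
  have h2 : localOsc univ F x t ≤
      (K * volume (Metric.ball (0 : EuclideanSpace ℝ (Fin d)) 1) + ENNReal.ofReal (2 ^ (d + 1))) *
        ENNReal.ofReal ((t / δ) ^ (d + 1)) * localOsc univ F x (8 * δ) := by
    rcases le_or_gt t (δ / 2) with h | h
    · refine (H.localOsc_le_small hr hΩ hx (by linarith) ht0 h).trans ?_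
      gcongr
      exact le_self_add
    · refine (localOsc_mono univ F x ht.le).trans ?_
      rw [add_mul]
      refine le_mul_of_one_le_left' (le_add_left ?_)
      rw [← ENNReal.ofReal_mul (by positivity), ← mul_pow, ENNReal.one_le_ofReal]
      refine one_le_pow₀ ?_
      rw [← mul_div_assoc, one_le_div hx]
      linarith
  refine h2.trans ?_
  calc _ ≤ (K * volume (Metric.ball (0 : EuclideanSpace ℝ (Fin d)) 1) +
        ENNReal.ofReal (2 ^ (d + 1))) * ENNReal.ofReal ((t / δ) ^ (d + 1)) *
        ((1 + K) * ∫⁻ z, w x z * localOsc Ω f z (2 * (100 * δ))) := by gcongr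
    _ = _ := by ring

lemma triebelInner_le_near (H : IsAveraging r K Ω f E w) (hr : 0 < r)
    (hΩ : MeasurableSet Ω) (hnull : ∀ᵐ x, x ∈ Ω ∨ 0 < Metric.infDist x Ω) (hf : Measurable f)
    (hs : 0 < s) (hq : 1 ≤ q)
    (hx : 0 < Metric.infDist x Ω) (hxr : Metric.infDist x Ω ≤ r / 160) (ht0 : 0 < t)
    (ht : t < 8 * Metric.infDist x Ω) :
    triebelInner d univ (collarExtension r Ω f E) s 1 x t ≤
      (K * volume (Metric.ball (0 : EuclideanSpace ℝ (Fin d)) 1) + ENNReal.ofReal (2 ^ (d + 1))) *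
        (1 + K) * ENNReal.ofReal (8 ^ (1 - s) * 400 ^ (s + d)) * 2 *
        (ENNReal.ofReal ((t / (8 * Metric.infDist x Ω)) ^ (1 - s)) *
        ∫⁻ z, w x z * eLpNorm (triebelInner d Ω f s 1 z) q (scaleMeasure (4 * r))) := by
  have hwm : Measurable (w x) := H.measurable_weight.of_uncurry_left
  have hhm : Measurable fun z =>
      w x z * eLpNorm (triebelInner d Ω f s 1 z) q (scaleMeasure (4 * r)) :=
    hwm.mul (measurable_eLpNorm_right (measurable_triebelInner_one hΩ hf s) q)
  have hJm : Measurable fun z => w x z * localOsc Ω f z (2 * (100 * Metric.infDist x Ω)) :=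
    hwm.mul (measurable_localOsc hΩ hf).of_uncurry_right
  have h1 := H.localOsc_le_near hr hΩ hnull hf hx hxr ht0 ht
  set δ := Metric.infDist x Ω
  have hJ : ENNReal.ofReal ((400 * δ) ^ (-(s + d))) *
      (∫⁻ z, w x z * localOsc Ω f z (2 * (100 * δ))) ≤
      2 * ∫⁻ z, w x z * eLpNorm (triebelInner d Ω f s 1 z) q (scaleMeasure (4 * r)) := by
    rw [← lintegral_const_mul _ hJm, ← lintegral_const_mul _ hhm]
    refine lintegral_mono fun z => ?_
    have := localOsc_le_eLpNorm_triebelInner (q := q) Ω f hs z (a := 2 * (100 * δ)) (R := 4 * r)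
      (by positivity) (by linarith) hq
    rw [show 2 * (2 * (100 * δ)) = 400 * δ by ring] at this
    exact (mul_left_comm _ _ _).trans_le
      ((mul_le_mul' le_rfl this).trans_eq (mul_left_comm _ _ _))
  have hpow : t ^ (-(s + d)) * (t / δ) ^ (d + 1) =
      8 ^ (1 - s) * 400 ^ (s + d) * (t / (8 * δ)) ^ (1 - s) * (400 * δ) ^ (-(s + d)) := by
    have e1 : t ^ (1 - s) = t ^ (-(s + d)) * t ^ (d + 1) := by
      rw [← Real.rpow_natCast, ← Real.rpow_add ht0]
      congr 1
      push_cast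
      ring
    have e2 : δ ^ (-(s + d)) * δ ^ (d + 1) = δ ^ (1 - s) := by
      rw [← Real.rpow_natCast, ← Real.rpow_add hx]
      congr 1
      push_cast
      ring
    rw [Real.div_rpow ht0.le (by positivity), Real.mul_rpow (by norm_num) hx.le,
      Real.mul_rpow (by norm_num) hx.le, Real.rpow_neg (by norm_num : (0 : ℝ) ≤ 400), e1, ← e2,
      div_pow]
    have : (0 : ℝ) < δ ^ (-(s + d)) := by positivity
    field_simp
  rw [triebelInner_one]
  refine (mul_le_mul' le_rfl h1).trans ?_
  calc _ = (K * volume (Metric.ball (0 : EuclideanSpace ℝ (Fin d)) 1) +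
          ENNReal.ofReal (2 ^ (d + 1))) * (1 + K) *
        (ENNReal.ofReal (t ^ (-(s + d))) * ENNReal.ofReal ((t / δ) ^ (d + 1))) *
        ∫⁻ z, w x z * localOsc Ω f z (2 * (100 * δ)) := by ring
    _ = (K * volume (Metric.ball (0 : EuclideanSpace ℝ (Fin d)) 1) +
          ENNReal.ofReal (2 ^ (d + 1))) * (1 + K) *
        ENNReal.ofReal (8 ^ (1 - s) * 400 ^ (s + d)) *
        ENNReal.ofReal ((t / (8 * δ)) ^ (1 - s)) *
        (ENNReal.ofReal ((400 * δ) ^ (-(s + d))) *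
        ∫⁻ z, w x z * localOsc Ω f z (2 * (100 * δ))) := by
        rw [← ENNReal.ofReal_mul (by positivity), hpow, ENNReal.ofReal_mul (by positivity),
          ENNReal.ofReal_mul (by positivity)]
        ring
    _ ≤ _ * (2 * _) := mul_le_mul' le_rfl hJ
    _ = _ := by ring

lemma triebelInner_le_far (H : IsAveraging r K Ω f E w) (hr : 0 < r)
    {η : ℝ} (hη : 0 < η) (hx : η ≤ Metric.infDist x Ω) (hf : Measurable f) (ht0 : 0 < t)
    (ht : t ≤ η / 2) (htr : t ≤ r / 4) :
    triebelInner d univ (collarExtension r Ω f E) s 1 x t ≤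
      (K * ENNReal.ofReal (1 / η ^ (d + 1)) * (1 + ENNReal.ofReal ((8 * r) ^ d) *
          volume (Metric.ball (0 : EuclideanSpace ℝ (Fin d)) 1)) + ENNReal.ofReal (4 / r)) *
        volume (Metric.ball (0 : EuclideanSpace ℝ (Fin d)) 1) * (ENNReal.ofReal (t ^ (1 - s)) *
        ((∫⁻ z in Metric.ball x (8 * r) ∩ Ω, ‖f z‖ₑ) + ∫⁻ z, w x z * ‖f z‖ₑ)) := by
  have e1 : t ^ (1 - s) = t ^ (-(s + d)) * t ^ (d + 1) := by
    rw [← Real.rpow_natCast, ← Real.rpow_add ht0]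
    congr 1
    push_cast
    ring
  rw [triebelInner_one, e1, ENNReal.ofReal_mul (by positivity), mul_assoc, mul_left_comm]
  refine (mul_le_mul' le_rfl (H.localOsc_le_far hr hη hx hf ht0 ht htr)).trans (le_of_eq ?_)
  ring

end IsAveraging

lemma triebelInner_univ_le_of_le {d : ℕ} {F : EuclideanSpace ℝ (Fin d) → ℝ}
    (x : EuclideanSpace ℝ (Fin d)) {a s t : ℝ} (ha : 0 < a) (hat : a ≤ t) (ht : t ≤ 1) :
    triebelInner d univ F s 1 x t ≤
      ENNReal.ofReal (a ^ (-(1 + d : ℝ))) *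
        (volume (Metric.ball (0 : EuclideanSpace ℝ (Fin d)) 1) + 1) *
        (ENNReal.ofReal (t ^ (1 - s)) * (‖F x‖ₑ + ∫⁻ y in Metric.ball x 1, ‖F y‖ₑ)) := by
  have ht0 := ha.trans_le hat
  have e : t ^ (-(s + d)) ≤ a ^ (-(1 + d : ℝ)) * t ^ (1 - s) := by
    have : t ^ (-(s + d)) = t ^ (-(1 + d : ℝ)) * t ^ (1 - s) := by
      rw [← Real.rpow_add ht0]
      congr 1
      ring
    rw [this]
    refine mul_le_mul_of_nonneg_right (Real.rpow_le_rpow_of_nonpos ha hat ?_) (by positivity)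
    have : (0 : ℝ) ≤ d := by positivity
    linarith
  rw [triebelInner_one]
  set V := volume (Metric.ball (0 : EuclideanSpace ℝ (Fin d)) 1)
  set I := ∫⁻ y in Metric.ball x 1, ‖F y‖ₑ
  calc _ ≤ ENNReal.ofReal (a ^ (-(1 + d : ℝ)) * t ^ (1 - s)) * (V * ‖F x‖ₑ + I) := by
        gcongr
        exact localOsc_univ_le x ht
    _ ≤ ENNReal.ofReal (a ^ (-(1 + d : ℝ)) * t ^ (1 - s)) * ((V + 1) * (‖F x‖ₑ + I)) := by
        gcongr
        rw [mul_add]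
        gcongr
        · exact le_self_add
        · exact le_mul_of_one_le_left' le_add_self
    _ = _ := by rw [ENNReal.ofReal_mul (by positivity)]; ring

/-- The constant in the pointwise estimate of the extension. -/
def collarConst (d : ℕ) (r : ℝ) (K : NNReal) (s : ℝ) : ℝ≥0∞ :=
  (1 + K) * ENNReal.ofReal (5 ^ (s + d)) + (1 + K) * ENNReal.ofReal (25 ^ (s + d)) +
  (K * volume (Metric.ball (0 : EuclideanSpace ℝ (Fin d)) 1) + ENNReal.ofReal (2 ^ (d + 1))) *
    (1 + K) * ENNReal.ofReal (8 ^ (1 - s) * 400 ^ (s + d)) * 2 +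
  (K * ENNReal.ofReal (1 / (r / 160) ^ (d + 1)) * (1 + ENNReal.ofReal ((8 * r) ^ d) *
    volume (Metric.ball (0 : EuclideanSpace ℝ (Fin d)) 1)) + ENNReal.ofReal (4 / r)) *
    volume (Metric.ball (0 : EuclideanSpace ℝ (Fin d)) 1) +
  ENNReal.ofReal ((r / 320) ^ (-(1 + d : ℝ))) *
    (volume (Metric.ball (0 : EuclideanSpace ℝ (Fin d)) 1) + 1)

lemma collarConst_ne_top (d : ℕ) (r : ℝ) (K : NNReal) (s : ℝ) : collarConst d r K s ≠ ⊤ := by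
  have hV : volume (Metric.ball (0 : EuclideanSpace ℝ (Fin d)) 1) ≠ ⊤ :=
    measure_ball_lt_top.ne
  unfold collarConst
  finiteness

/-- The part of the pointwise estimate of the extension that does not involve differences. -/
def collarTail {d : ℕ} (r : ℝ) (Ω : Set (EuclideanSpace ℝ (Fin d)))
    (f F : EuclideanSpace ℝ (Fin d) → ℝ)
    (w : EuclideanSpace ℝ (Fin d) → EuclideanSpace ℝ (Fin d) → ℝ≥0∞)
    (x : EuclideanSpace ℝ (Fin d)) : ℝ≥0∞ :=
  (‖F x‖ₑ + ∫⁻ y in Metric.ball x 1, ‖F y‖ₑ) +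
    ((∫⁻ z in Metric.ball x (8 * r) ∩ Ω, ‖f z‖ₑ) + ∫⁻ z, w x z * ‖f z‖ₑ)

namespace IsAveraging

variable {d : ℕ} {r : ℝ} {K : NNReal} {Ω : Set (EuclideanSpace ℝ (Fin d))}
  {f E : EuclideanSpace ℝ (Fin d) → ℝ}
  {w : EuclideanSpace ℝ (Fin d) → EuclideanSpace ℝ (Fin d) → ℝ≥0∞}
  {x : EuclideanSpace ℝ (Fin d)} {s t : ℝ} {q : ℝ≥0∞}

lemma triebelInner_le (H : IsAveraging r K Ω f E w) (hr : 0 < r)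
    (hΩ : MeasurableSet Ω) (hnull : ∀ᵐ x, x ∈ Ω ∨ 0 < Metric.infDist x Ω) (hf : Measurable f)
    (hs : 0 < s) (hq : 1 ≤ q) (hx : x ∈ Ω ∨ 0 < Metric.infDist x Ω) (ht : t ∈ Ioo (0 : ℝ) 1) :
    triebelInner d univ (collarExtension r Ω f E) s 1 x t ≤
      collarConst d r K s *
        (Ω.indicator (fun x => (Iio (r / 320)).indicator
            (fun t => triebelInner d Ω f s 1 x (5 * t)) t) x +
          (∫⁻ z, w x z * (Iio (r / 320)).indicator
            (fun t => triebelInner d Ω f s 1 z (25 * t)) t) +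
          (∫⁻ z, w x z * eLpNorm (triebelInner d Ω f s 1 z) q (scaleMeasure (4 * r))) *
            (Iio (8 * Metric.infDist x Ω)).indicator
              (fun t => ENNReal.ofReal ((t / (8 * Metric.infDist x Ω)) ^ (1 - s))) t +
          collarTail r Ω f (collarExtension r Ω f E) w x * ENNReal.ofReal (t ^ (1 - s))) := by
  rcases le_or_gt (r / 320) t with h | h
  · refine (triebelInner_univ_le_of_le x (by positivity) h ht.2.le).trans ?_
    refine mul_le_mul' le_add_self (le_trans ?_ le_add_self)
    rw [mul_comm]
    exact mul_le_mul' le_self_add le_rfl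
  by_cases hxΩ : x ∈ Ω
  · refine (H.triebelInner_le_of_mem hr hΩ hnull hf hxΩ ht.1 (by linarith)).trans ?_
    rw [indicator_of_mem hxΩ, indicator_of_mem (mem_Iio.2 h)]
    refine mul_le_mul' ?_ ?_
    · simp only [collarConst, add_assoc]
      exact le_self_add
    · simp only [add_assoc]
      exact le_self_add
  replace hx := hx.resolve_left hxΩ
  rcases le_or_gt (r / 160) (Metric.infDist x Ω) with h1 | h1
  · refine (H.triebelInner_le_far hr (by positivity) h1 hf ht.1 (by linarith) (by linarith)).trans
      ?_
    refine mul_le_mul' (le_trans le_add_self le_self_add) (le_trans ?_ le_add_self)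
    rw [mul_comm]
    exact mul_le_mul' le_add_self le_rfl
  rcases le_or_gt (8 * Metric.infDist x Ω) t with h2 | h2
  · refine (H.triebelInner_le_lintegral hr hΩ hnull hf hx (by linarith) (by linarith)).trans ?_
    simp only [indicator_of_mem (mem_Iio.2 h)]
    refine mul_le_mul' ?_ ?_
    · exact le_add_right (le_add_right (le_add_right le_add_self))
    · exact le_add_right (le_add_right le_add_self)
  · refine (H.triebelInner_le_near hr hΩ hnull hf hs hq hx h1.le ht.1 h2).trans ?_
    simp only [indicator_of_mem (mem_Iio.2 h2)]
    refine mul_le_mul' ?_ ?_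
    · exact le_add_right (le_add_right le_add_self)
    · rw [mul_comm]
      exact le_add_right le_add_self

lemma eLpNorm_triebelInner_le (H : IsAveraging r K Ω f E w) (hr : 0 < r)
    (hΩ : MeasurableSet Ω) (hnull : ∀ᵐ x, x ∈ Ω ∨ 0 < Metric.infDist x Ω) (hf : Measurable f)
    (hs : 0 < s) (hs1 : s < 1) (hq : 1 ≤ q) (hx : x ∈ Ω ∨ 0 < Metric.infDist x Ω) :
    eLpNorm (triebelInner d univ (collarExtension r Ω f E) s 1 x) q (scaleMeasure 1) ≤
      collarConst d r K s * (ENNReal.ofReal (1 + 1 / (1 - s)) + 1) *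
        (Ω.indicator (fun x => eLpNorm (triebelInner d Ω f s 1 x) q (scaleMeasure (4 * r))) x +
          (∫⁻ z, w x z * eLpNorm (triebelInner d Ω f s 1 z) q (scaleMeasure (4 * r))) +
          collarTail r Ω f (collarExtension r Ω f E) w x) := by
  have hG := measurable_triebelInner_one hΩ hf s
  have hw : Measurable (w x) := H.measurable_weight.of_uncurry_left
  have hκ : 0 < 1 - s := by linarith
  set c := ENNReal.ofReal (1 + 1 / (1 - s))
  set T := Ω.indicator (fun x => eLpNorm (triebelInner d Ω f s 1 x) q (scaleMeasure (4 * r))) x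
    with hT
  set W := ∫⁻ z, w x z * eLpNorm (triebelInner d Ω f s 1 z) q (scaleMeasure (4 * r))
  set m := collarTail r Ω f (collarExtension r Ω f E) w x
  set φ₁ : ℝ → ℝ≥0∞ := fun t => Ω.indicator (fun x => (Iio (r / 320)).indicator
    (fun t => triebelInner d Ω f s 1 x (5 * t)) t) x with hφ₁
  have hGz : Measurable (Function.uncurry fun z t => w x z * (Iio (r / 320)).indicator
      (fun t => triebelInner d Ω f s 1 z (25 * t)) t) := by
    refine (hw.comp measurable_fst).mul ?_
    have h25 : Measurable fun p : EuclideanSpace ℝ (Fin d) × ℝ =>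
        triebelInner d Ω f s 1 p.1 (25 * p.2) :=
      hG.comp (measurable_fst.prodMk (measurable_snd.const_mul 25))
    exact h25.indicator (measurable_snd measurableSet_Iio)
  set φ₂ : ℝ → ℝ≥0∞ := fun t => ∫⁻ z, w x z * (Iio (r / 320)).indicator
    (fun t => triebelInner d Ω f s 1 z (25 * t)) t
  set φ₃ : ℝ → ℝ≥0∞ := fun t => (Iio (8 * Metric.infDist x Ω)).indicator
    (fun t => ENNReal.ofReal ((t / (8 * Metric.infDist x Ω)) ^ (1 - s))) t with hφ₃
  set φ₄ : ℝ → ℝ≥0∞ := fun t => ENNReal.ofReal (t ^ (1 - s))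
  have m₁ : Measurable φ₁ := by
    by_cases hxΩ : x ∈ Ω
    · simp only [hφ₁, indicator_of_mem hxΩ]
      have h5 : Measurable fun t : ℝ => triebelInner d Ω f s 1 x (5 * t) :=
        (hG.of_uncurry_left (x := x)).comp (measurable_id.const_mul 5)
      exact h5.indicator measurableSet_Iio
    · simp only [hφ₁, indicator_of_notMem hxΩ]
      exact measurable_const
  have m₂ : Measurable φ₂ := hGz.lintegral_prod_left
  have m₃ : Measurable φ₃ := Measurable.indicator (by fun_prop) measurableSet_Iio
  have m₄ : Measurable φ₄ := by fun_prop
  have n₁ : eLpNorm φ₁ q (scaleMeasure 1) ≤ T := by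
    by_cases hxΩ : x ∈ Ω
    · simp only [hφ₁, hT, indicator_of_mem hxΩ]
      exact eLpNorm_indicator_Iio_comp_mul_le (by norm_num) (by linarith) _
    · simp [hφ₁, indicator_of_notMem hxΩ]
  have n₂ : eLpNorm φ₂ q (scaleMeasure 1) ≤ W := by
    refine (eLpNorm_lintegral_le hGz hq).trans (lintegral_mono fun z => ?_)
    have h25 : Measurable fun t : ℝ => (Iio (r / 320)).indicator
        (fun t => triebelInner d Ω f s 1 z (25 * t)) t := by
      have h25 : Measurable fun t : ℝ => triebelInner d Ω f s 1 z (25 * t) :=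
        (hG.of_uncurry_left (x := z)).comp (measurable_id.const_mul 25)
      exact h25.indicator measurableSet_Iio
    rw [eLpNorm_ennreal_const_mul _ h25]
    exact mul_le_mul' le_rfl (eLpNorm_indicator_Iio_comp_mul_le (by norm_num) (by linarith) _)
  have n₃ : eLpNorm φ₃ q (scaleMeasure 1) ≤ c := by
    rcases (Metric.infDist_nonneg (x := x) (s := Ω)).eq_or_lt with h0 | h0
    · refine (eLpNorm_congr_ae (g := 0) ?_).trans_le (by simp)
      filter_upwards [ae_scaleMeasure_mem 1] with t ht
      simp [hφ₃, ← h0, not_lt.2 ht.1.le]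
    · exact eLpNorm_indicator_rpow_scaleMeasure_le hκ hq (by positivity) _
  have n₄ : eLpNorm φ₄ q (scaleMeasure 1) ≤ c := eLpNorm_rpow_scaleMeasure_le hκ hq
  have hle : eLpNorm (triebelInner d univ (collarExtension r Ω f E) s 1 x) q (scaleMeasure 1) ≤
      eLpNorm (fun t => collarConst d r K s * (((φ₁ + φ₂) + (fun t => W * φ₃ t) +
        fun t => m * φ₄ t) t)) q (scaleMeasure 1) := by
    refine eLpNorm_mono_enorm_ae ?_
    filter_upwards [ae_scaleMeasure_mem 1] with t ht
    exact H.triebelInner_le hr hΩ hnull hf hs hq hx ht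
  refine hle.trans ?_
  have m₁₂ := m₁.add m₂
  have m₁₂₃ := m₁₂.add (m₃.const_mul W)
  have m₁₂₃₄ := m₁₂₃.add (m₄.const_mul m)
  rw [eLpNorm_ennreal_const_mul _ m₁₂₃₄, mul_assoc]
  refine mul_le_mul' le_rfl ?_
  calc _ ≤ ((eLpNorm φ₁ q (scaleMeasure 1) + eLpNorm φ₂ q (scaleMeasure 1)) +
        W * eLpNorm φ₃ q (scaleMeasure 1)) + m * eLpNorm φ₄ q (scaleMeasure 1) := by
        rw [← eLpNorm_ennreal_const_mul W m₃, ← eLpNorm_ennreal_const_mul m m₄]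
        refine (eLpNorm_add_le m₁₂₃.aestronglyMeasurable
          (m₄.const_mul m).aestronglyMeasurable hq).trans (add_le_add ?_ le_rfl)
        refine (eLpNorm_add_le m₁₂.aestronglyMeasurable
          (m₃.const_mul W).aestronglyMeasurable hq).trans (add_le_add ?_ le_rfl)
        exact eLpNorm_add_le m₁.aestronglyMeasurable m₂.aestronglyMeasurable hq
    _ ≤ ((T + W) + W * c) + m * c := by gcongr
    _ ≤ ((T + W) + W * c) + m * c + (c * T + m) := le_self_add
    _ = _ := by ring

end IsAveraging

lemma triebelSeminorm_one_eq {d : ℕ} (U : Set (EuclideanSpace ℝ (Fin d)))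
    (f : EuclideanSpace ℝ (Fin d) → ℝ) (s ρ : ℝ) {p : ℝ} (hp : 1 ≤ p) {q : ℝ≥0∞} (hq : 1 ≤ q) :
    triebelSeminorm d U f s ρ p q 1 =
      eLpNorm (fun x => eLpNorm (triebelInner d U f s 1 x) q (scaleMeasure ρ)) (ENNReal.ofReal p)
        (volume.restrict U) := by
  have hp0 : 0 < p := by linarith
  rw [eLpNorm_eq_lintegral_rpow_enorm_toReal (by simpa using hp0) ENNReal.ofReal_ne_top,
    ENNReal.toReal_ofReal hp0.le]
  simp only [enorm_eq_self, eLpNorm_scaleMeasure ρ hq]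
  rfl

lemma measurable_setLIntegral_ball {d : ℕ} {h : EuclideanSpace ℝ (Fin d) → ℝ≥0∞}
    (hh : Measurable h) (ρ : ℝ) : Measurable fun x => ∫⁻ z in Metric.ball x ρ, h z := by
  have hS : MeasurableSet {a : EuclideanSpace ℝ (Fin d) × EuclideanSpace ℝ (Fin d) |
      dist a.2 a.1 < ρ} :=
    measurableSet_lt (measurable_snd.dist measurable_fst) measurable_const
  simp only [← lintegral_indicator Metric.isOpen_ball.measurableSet]
  exact ((hh.comp measurable_snd).indicator hS).lintegral_prod_right'

lemma setLIntegral_ball_inter {d : ℕ} {U : Set (EuclideanSpace ℝ (Fin d))} (hU : MeasurableSet U)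
    (h : EuclideanSpace ℝ (Fin d) → ℝ≥0∞) (ρ : ℝ) (x : EuclideanSpace ℝ (Fin d)) :
    ∫⁻ z in Metric.ball x ρ ∩ U, h z = ∫⁻ z in Metric.ball x ρ, U.indicator h z := by
  rw [lintegral_indicator hU, Measure.restrict_restrict hU, inter_comm]

lemma eLpNorm_setLIntegral_ball_le {d : ℕ} {h : EuclideanSpace ℝ (Fin d) → ℝ≥0∞}
    (hh : Measurable h) (ρ : ℝ) {p : ℝ} (hp : 1 ≤ p) :
    eLpNorm (fun x => ∫⁻ z in Metric.ball x ρ, h z) (ENNReal.ofReal p) volume ≤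
      volume (Metric.ball (0 : EuclideanSpace ℝ (Fin d)) ρ) *
        eLpNorm h (ENNReal.ofReal p) volume := by
  have hk : Measurable (Function.uncurry fun x z : EuclideanSpace ℝ (Fin d) =>
      (Metric.ball x ρ).indicator (fun _ => (1 : ℝ≥0∞)) z) := by
    have hS : MeasurableSet {a : EuclideanSpace ℝ (Fin d) × EuclideanSpace ℝ (Fin d) |
        dist a.2 a.1 < ρ} :=
      measurableSet_lt (measurable_snd.dist measurable_fst) measurable_const
    exact (measurable_const (a := (1 : ℝ≥0∞))).indicator hS
  have hA : ∀ x : EuclideanSpace ℝ (Fin d), ∫⁻ z, (Metric.ball x ρ).indicator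
      (fun _ => (1 : ℝ≥0∞)) z ≤ volume (Metric.ball (0 : EuclideanSpace ℝ (Fin d)) ρ) := by
    intro x
    rw [lintegral_indicator Metric.isOpen_ball.measurableSet]
    simp [Measure.addHaar_ball_center volume x]
  have hB : ∀ z : EuclideanSpace ℝ (Fin d), ∫⁻ x, (Metric.ball x ρ).indicator
      (fun _ => (1 : ℝ≥0∞)) z ≤ volume (Metric.ball (0 : EuclideanSpace ℝ (Fin d)) ρ) := by
    intro z
    refine (lintegral_congr fun x => ?_).trans_le (hA z)
    simp only [indicator, Metric.mem_ball, dist_comm]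
  refine le_trans (le_of_eq ?_) (eLpNorm_lintegral_mul_le hk hA hB hh hp)
  congr 1
  ext x
  rw [← lintegral_indicator Metric.isOpen_ball.measurableSet]
  refine lintegral_congr fun z => ?_
  simp only [indicator, ite_mul, one_mul, zero_mul]

namespace IsAveraging

variable {d : ℕ} {r : ℝ} {K : NNReal} {Ω : Set (EuclideanSpace ℝ (Fin d))}
  {f E : EuclideanSpace ℝ (Fin d) → ℝ}
  {w : EuclideanSpace ℝ (Fin d) → EuclideanSpace ℝ (Fin d) → ℝ≥0∞}
  {s p : ℝ} {q : ℝ≥0∞}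

lemma lintegral_mul_indicator (H : IsAveraging r K Ω f E w) (h : EuclideanSpace ℝ (Fin d) → ℝ≥0∞)
    (x : EuclideanSpace ℝ (Fin d)) : ∫⁻ z, w x z * Ω.indicator h z = ∫⁻ z, w x z * h z := by
  refine lintegral_congr fun z => ?_
  rcases eq_or_ne (w x z) 0 with h0 | h0
  · simp [h0]
  · rw [indicator_of_mem (H.supp x z h0).1]

lemma eLpNorm_lintegral_weight_le (H : IsAveraging r K Ω f E w) (hΩ : MeasurableSet Ω)
    {h : EuclideanSpace ℝ (Fin d) → ℝ≥0∞} (hh : Measurable h) (hp : 1 ≤ p) :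
    eLpNorm (fun x => ∫⁻ z, w x z * h z) (ENNReal.ofReal p) volume ≤
      (1 + K) * eLpNorm (Ω.indicator h) (ENNReal.ofReal p) volume := by
  simp only [← H.lintegral_mul_indicator h]
  exact eLpNorm_lintegral_mul_le H.measurable_weight (fun x => (H.mass_le x).trans le_self_add)
    (fun z => (H.comass_le z).trans le_add_self) (hh.indicator hΩ) hp

lemma enorm_collarExtension_le (H : IsAveraging r K Ω f E w) (hr : 0 < r)
    {x : EuclideanSpace ℝ (Fin d)} (hx : x ∈ Ω ∨ 0 < Metric.infDist x Ω) :
    ‖collarExtension r Ω f E x‖ₑ ≤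
      Ω.indicator (fun z => ‖f z‖ₑ) x + ∫⁻ z, w x z * ‖f z‖ₑ := by
  rcases hx with hx | hx
  · rw [collarExtension_of_mem hx, indicator_of_mem hx]
    exact le_self_add
  · rw [collarExtension_of_pos hx]
    refine le_add_left ?_
    rcases le_or_gt (Metric.infDist x Ω) r with h | h
    · rw [enorm_mul]
      refine (mul_le_of_le_one_left' ?_).trans (by simpa using H.dev_le x hx h 0)
      rw [Real.enorm_eq_ofReal collarCutoff_nonneg]
      exact ENNReal.ofReal_le_one.2 collarCutoff_le_one
    · rw [collarCutoff_eq_zero hr (by linarith)]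
      simp

lemma lpNormOn_univ_collarExtension_le (H : IsAveraging r K Ω f E w) (hr : 0 < r)
    (hΩ : MeasurableSet Ω) (hnull : ∀ᵐ x, x ∈ Ω ∨ 0 < Metric.infDist x Ω) (hf : Measurable f)
    (hp : 1 ≤ p) :
    lpNormOn d univ (collarExtension r Ω f E) p ≤ (2 + K) * lpNormOn d Ω f p := by
  have hN : lpNormOn d Ω f p =
      eLpNorm (Ω.indicator fun z => ‖f z‖ₑ) (ENNReal.ofReal p) volume := by
    rw [eLpNorm_indicator_eq_eLpNorm_restrict hΩ, eLpNorm_enorm, lpNormOn]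
  have hP : 1 ≤ ENNReal.ofReal p := ENNReal.one_le_ofReal.2 hp
  have hm : Measurable fun x => ∫⁻ z, w x z * ‖f z‖ₑ :=
    (H.measurable_weight.mul (hf.enorm.comp measurable_snd)).lintegral_prod_right
  rw [hN, lpNormOn, Measure.restrict_univ]
  calc _ ≤ eLpNorm ((Ω.indicator fun z => ‖f z‖ₑ) + fun x => ∫⁻ z, w x z * ‖f z‖ₑ)
        (ENNReal.ofReal p) volume := by
        refine eLpNorm_mono_enorm_ae ?_
        filter_upwards [hnull] with x hx
        exact H.enorm_collarExtension_le hr hx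
    _ ≤ _ := eLpNorm_add_le (hf.enorm.indicator hΩ).aestronglyMeasurable
        hm.aestronglyMeasurable hP
    _ ≤ eLpNorm (Ω.indicator fun z => ‖f z‖ₑ) (ENNReal.ofReal p) volume + (1 + K) *
        eLpNorm (Ω.indicator fun z => ‖f z‖ₑ) (ENNReal.ofReal p) volume :=
        add_le_add le_rfl (H.eLpNorm_lintegral_weight_le hΩ hf.enorm hp)
    _ = _ := by ring

lemma measurable_collarTail (H : IsAveraging r K Ω f E w) (hΩ : MeasurableSet Ω)
    (hf : Measurable f) {F : EuclideanSpace ℝ (Fin d) → ℝ} (hF : Measurable F) :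
    Measurable (collarTail r Ω f F w) := by
  refine (hF.enorm.add (measurable_setLIntegral_ball hF.enorm 1)).add (Measurable.add ?_
    (H.measurable_weight.mul (hf.enorm.comp measurable_snd)).lintegral_prod_right)
  simp only [setLIntegral_ball_inter hΩ]
  exact measurable_setLIntegral_ball (hf.enorm.indicator hΩ) _

lemma eLpNorm_collarTail_le (H : IsAveraging r K Ω f E w)
    (hΩ : MeasurableSet Ω) (hf : Measurable f) {F : EuclideanSpace ℝ (Fin d) → ℝ}
    (hF : Measurable F) (hp : 1 ≤ p) :
    eLpNorm (collarTail r Ω f F w) (ENNReal.ofReal p) volume ≤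
      (1 + volume (Metric.ball (0 : EuclideanSpace ℝ (Fin d)) 1)) * lpNormOn d univ F p +
      (volume (Metric.ball (0 : EuclideanSpace ℝ (Fin d)) (8 * r)) + (1 + K)) *
        lpNormOn d Ω f p := by
  have hN : lpNormOn d Ω f p =
      eLpNorm (Ω.indicator fun z => ‖f z‖ₑ) (ENNReal.ofReal p) volume := by
    rw [eLpNorm_indicator_eq_eLpNorm_restrict hΩ, eLpNorm_enorm, lpNormOn]
  have hP : 1 ≤ ENNReal.ofReal p := ENNReal.one_le_ofReal.2 hp
  have hr8 : (fun x => ∫⁻ z in Metric.ball x (8 * r) ∩ Ω, ‖f z‖ₑ) =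
      fun x => ∫⁻ z in Metric.ball x (8 * r), Ω.indicator (fun z => ‖f z‖ₑ) z :=
    funext fun x => setLIntegral_ball_inter hΩ _ _ x
  have m₁ : Measurable fun x => ‖F x‖ₑ := hF.enorm
  have m₂ : Measurable fun x => ∫⁻ y in Metric.ball x 1, ‖F y‖ₑ := measurable_setLIntegral_ball m₁ 1
  have m₃ : Measurable fun x => ∫⁻ z in Metric.ball x (8 * r) ∩ Ω, ‖f z‖ₑ := by
    rw [hr8]
    exact measurable_setLIntegral_ball (hf.enorm.indicator hΩ) _
  have m₄ : Measurable fun x => ∫⁻ z, w x z * ‖f z‖ₑ :=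
    (H.measurable_weight.mul (hf.enorm.comp measurable_snd)).lintegral_prod_right
  have n₂ := eLpNorm_setLIntegral_ball_le m₁ 1 hp
  have n₃ := eLpNorm_setLIntegral_ball_le (hf.enorm.indicator hΩ) (8 * r) hp
  rw [← hr8, ← hN] at n₃
  have n₄ := H.eLpNorm_lintegral_weight_le hΩ hf.enorm hp
  rw [← hN] at n₄
  have hF' : lpNormOn d univ F p = eLpNorm (fun x => ‖F x‖ₑ) (ENNReal.ofReal p) volume := by
    rw [eLpNorm_enorm, lpNormOn, Measure.restrict_univ]
  rw [← hF'] at n₂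
  refine (eLpNorm_add_le (m₁.add m₂).aestronglyMeasurable (m₃.add m₄).aestronglyMeasurable
    hP).trans ?_
  rw [add_mul, add_mul, one_mul]
  refine add_le_add ?_ ?_
  · refine (eLpNorm_add_le m₁.aestronglyMeasurable m₂.aestronglyMeasurable hP).trans ?_
    exact add_le_add hF'.ge n₂
  · refine (eLpNorm_add_le m₃.aestronglyMeasurable m₄.aestronglyMeasurable hP).trans ?_
    exact add_le_add n₃ n₄

lemma triebelSeminorm_univ_collarExtension_le (H : IsAveraging r K Ω f E w) (hr : 0 < r)
    (hΩ : MeasurableSet Ω) (hnull : ∀ᵐ x, x ∈ Ω ∨ 0 < Metric.infDist x Ω) (hf : Measurable f)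
    (hs : 0 < s) (hs1 : s < 1) (hp : 1 ≤ p) (hq : 1 ≤ q) :
    triebelSeminorm d univ (collarExtension r Ω f E) s 1 p q 1 ≤
      collarConst d r K s * (ENNReal.ofReal (1 + 1 / (1 - s)) + 1) *
        ((2 + K) * triebelSeminorm d Ω f s (4 * r) p q 1 +
          ((1 + volume (Metric.ball (0 : EuclideanSpace ℝ (Fin d)) 1)) *
            lpNormOn d univ (collarExtension r Ω f E) p +
          (volume (Metric.ball (0 : EuclideanSpace ℝ (Fin d)) (8 * r)) + (1 + K)) *
            lpNormOn d Ω f p)) := by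
  have hFm : Measurable (collarExtension r Ω f E) :=
    measurable_collarExtension hΩ hf H.measurable_avg
  have hhm : Measurable fun z => eLpNorm (triebelInner d Ω f s 1 z) q (scaleMeasure (4 * r)) :=
    measurable_eLpNorm_right (measurable_triebelInner_one hΩ hf s) q
  have hN := H.eLpNorm_collarTail_le hΩ hf hFm hp
  have hP : 1 ≤ ENNReal.ofReal p := ENNReal.one_le_ofReal.2 hp
  rw [triebelSeminorm_one_eq _ _ _ _ hp hq, triebelSeminorm_one_eq _ _ _ _ hp hq,
    Measure.restrict_univ, ← eLpNorm_indicator_eq_eLpNorm_restrict hΩ]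
  set C := collarConst d r K s * (ENNReal.ofReal (1 + 1 / (1 - s)) + 1)
  set F := collarExtension r Ω f E
  set h := fun z => eLpNorm (triebelInner d Ω f s 1 z) q (scaleMeasure (4 * r))
  have m₁ : Measurable (Ω.indicator h) := hhm.indicator hΩ
  have m₂ : Measurable fun x => ∫⁻ z, w x z * h z :=
    (H.measurable_weight.mul (hhm.comp measurable_snd)).lintegral_prod_right
  have m₃ : Measurable (collarTail r Ω f F w) :=
    H.measurable_collarTail hΩ hf hFm
  refine (eLpNorm_mono_enorm_ae (g := fun x => C * ((Ω.indicator h + fun x => ∫⁻ z, w x z * h z) +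
    collarTail r Ω f F w) x) ?_).trans ?_
  · filter_upwards [hnull] with x hx
    exact H.eLpNorm_triebelInner_le hr hΩ hnull hf hs hs1 hq hx
  rw [eLpNorm_ennreal_const_mul _ ((m₁.add m₂).add m₃)]
  refine mul_le_mul' le_rfl ?_
  refine (eLpNorm_add_le (m₁.add m₂).aestronglyMeasurable m₃.aestronglyMeasurable hP).trans
    (add_le_add ?_ hN)
  refine (eLpNorm_add_le m₁.aestronglyMeasurable m₂.aestronglyMeasurable hP).trans ?_
  refine (add_le_add le_rfl (H.eLpNorm_lintegral_weight_le hΩ hhm hp)).trans (le_of_eq ?_)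
  ring

end IsAveraging

/-- The constant in the norm estimate of the extension. -/
def collarNormConst (d : ℕ) (r : ℝ) (K : NNReal) (s : ℝ) : ℝ≥0∞ :=
  (2 + K) + collarConst d r K s * (ENNReal.ofReal (1 + 1 / (1 - s)) + 1) *
    ((2 + K) + ((1 + volume (Metric.ball (0 : EuclideanSpace ℝ (Fin d)) 1)) * (2 + K) +
      (volume (Metric.ball (0 : EuclideanSpace ℝ (Fin d)) (8 * r)) + (1 + K))))

lemma collarNormConst_ne_top (d : ℕ) (r : ℝ) (K : NNReal) (s : ℝ) :
    collarNormConst d r K s ≠ ⊤ := by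
  have hV : volume (Metric.ball (0 : EuclideanSpace ℝ (Fin d)) 1) ≠ ⊤ :=
    measure_ball_lt_top.ne
  have hV' : volume (Metric.ball (0 : EuclideanSpace ℝ (Fin d)) (8 * r)) ≠ ⊤ :=
    measure_ball_lt_top.ne
  have := collarConst_ne_top d r K s
  unfold collarNormConst
  finiteness

lemma IsAveraging.norm_collarExtension_le {d : ℕ} {r : ℝ} {K : NNReal}
    {Ω : Set (EuclideanSpace ℝ (Fin d))} {f E : EuclideanSpace ℝ (Fin d) → ℝ}
    {w : EuclideanSpace ℝ (Fin d) → EuclideanSpace ℝ (Fin d) → ℝ≥0∞}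
    {s p : ℝ} {q : ℝ≥0∞} (H : IsAveraging r K Ω f E w) (hr : 0 < r)
    (hΩ : MeasurableSet Ω) (hnull : ∀ᵐ x, x ∈ Ω ∨ 0 < Metric.infDist x Ω) (hf : Measurable f)
    (hs : 0 < s) (hs1 : s < 1) (hp : 1 ≤ p) (hq : 1 ≤ q) :
    lpNormOn d univ (collarExtension r Ω f E) p +
        triebelSeminorm d univ (collarExtension r Ω f E) s 1 p q 1 ≤
      collarNormConst d r K s * (lpNormOn d Ω f p + triebelSeminorm d Ω f s (4 * r) p q 1) := by
  have h1 := H.lpNormOn_univ_collarExtension_le hr hΩ hnull hf hp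
  have h2 := H.triebelSeminorm_univ_collarExtension_le hr hΩ hnull hf hs hs1 hp hq
  set N := lpNormOn d Ω f p
  set T := triebelSeminorm d Ω f s (4 * r) p q 1
  set NF := lpNormOn d univ (collarExtension r Ω f E) p
  set TF := triebelSeminorm d univ (collarExtension r Ω f E) s 1 p q 1
  unfold collarNormConst
  set C := collarConst d r K s * (ENNReal.ofReal (1 + 1 / (1 - s)) + 1)
  set V := volume (Metric.ball (0 : EuclideanSpace ℝ (Fin d)) 1)
  set V' := volume (Metric.ball (0 : EuclideanSpace ℝ (Fin d)) (8 * r))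
  calc NF + TF ≤ (2 + K) * N +
        C * ((2 + K) * T + ((1 + V) * ((2 + K) * N) + (V' + (1 + K)) * N)) := by
        refine add_le_add h1 (h2.trans ?_)
        gcongr
    _ ≤ (2 + K) * (N + T) + C * ((2 + K) * (N + T) + ((1 + V) * ((2 + K) * (N + T)) +
        (V' + (1 + K)) * (N + T))) := by
        gcongr
        all_goals first | exact le_self_add | exact le_add_self
    _ = _ := by ring

lemma IsCorkscrew.volume_frontier_eq_zero {d : ℕ} {ε r : ℝ} {Ω : Set (EuclideanSpace ℝ (Fin d))}
    (h : IsCorkscrew d ε r Ω) (hε : 0 < ε) (hr : 0 < r) : volume (frontier Ω) = 0 := by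
  obtain ⟨hΩ, -, -, hcork⟩ := h
  have hS : MeasurableSet (frontier Ω) := isClosed_frontier.measurableSet
  have hd := Besicovitch.ae_tendsto_measure_inter_div volume (frontier Ω)
  have hF : ∀ᵐ x ∂(volume.restrict (frontier Ω)), False := by
    filter_upwards [hd, ae_restrict_mem hS] with x hx hxS
    have hlim : (1 : ℝ≥0∞) ≤ 1 - ENNReal.ofReal (ε ^ d) := by
      refine le_of_tendsto hx ?_
      filter_upwards [Ioc_mem_nhdsGT hr] with t ht
      obtain ⟨y, hy⟩ := hcork x hxS t ht.1 ht.2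
      have hV0 : volume (Metric.closedBall x t) ≠ 0 := (Metric.measure_closedBall_pos _ _ ht.1).ne'
      have hVt : volume (Metric.closedBall x t) ≠ ⊤ := measure_closedBall_lt_top.ne
      have hdisj : Disjoint (frontier Ω ∩ Metric.closedBall x t) (Metric.ball y (ε * t)) := by
        refine disjoint_left.2 fun z hz hz' => ?_
        rw [hΩ.frontier_eq] at hz
        exact hz.1.2 (hy hz').2
      have hball : volume (Metric.ball y (ε * t)) =
          ENNReal.ofReal (ε ^ d) * volume (Metric.closedBall x t) := by
        rw [Measure.addHaar_ball_of_pos _ _ (by positivity [ht.1]),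
          Measure.addHaar_closedBall _ _ ht.1.le, mul_pow, ENNReal.ofReal_mul (by positivity)]
        simp [mul_assoc]
      have hsum : volume (frontier Ω ∩ Metric.closedBall x t) +
          ENNReal.ofReal (ε ^ d) * volume (Metric.closedBall x t) ≤
          volume (Metric.closedBall x t) := by
        rw [← hball, ← measure_union hdisj Metric.isOpen_ball.measurableSet]
        refine measure_mono (union_subset inter_subset_right fun z hz => ?_)
        exact Metric.ball_subset_closedBall (hy hz).1
      refine ENNReal.le_sub_of_add_le_right ENNReal.ofReal_ne_top ?_
      rw [← ENNReal.mul_div_cancel_right (a := ENNReal.ofReal (ε ^ d)) hV0 hVt, ← ENNReal.add_div]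
      exact ENNReal.div_le_of_le_mul (by rwa [one_mul])
    refine absurd hlim (not_le.2 (ENNReal.sub_lt_self one_ne_top one_ne_zero ?_))
    simpa using pow_pos hε d
  simpa using hF

lemma IsCorkscrew.ae_mem_or_infDist_pos {d : ℕ} {ε r : ℝ} {Ω : Set (EuclideanSpace ℝ (Fin d))}
    (h : IsCorkscrew d ε r Ω) (hε : 0 < ε) (hr : 0 < r) :
    ∀ᵐ x, x ∈ Ω ∨ 0 < Metric.infDist x Ω := by
  filter_upwards [measure_eq_zero_iff_ae_notMem.1 (h.volume_frontier_eq_zero hε hr)] with x hx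
  refine or_iff_not_imp_left.2 fun hxΩ => Metric.infDist_nonneg.lt_of_ne fun h0 => hx ?_
  rw [h.1.frontier_eq]
  exact ⟨(Metric.mem_closure_iff_infDist_zero h.2.1).2 h0.symm, hxΩ⟩

/-- An unnormalized averaging kernel, centered near `x` and supported well inside `Ω`. -/
def collarKernel {d : ℕ} (ε : ℝ) (Ω : Set (EuclideanSpace ℝ (Fin d)))
    (x z : EuclideanSpace ℝ (Fin d)) : ℝ :=
  max 0 (min (4 * Metric.infDist x Ω - dist x z) (Metric.infDist z Ωᶜ - ε / 4 * Metric.infDist x Ω))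

section Kernel

variable {d : ℕ} {ε : ℝ} {Ω : Set (EuclideanSpace ℝ (Fin d))} {x y z : EuclideanSpace ℝ (Fin d)}

lemma collarKernel_nonneg : 0 ≤ collarKernel ε Ω x z := le_max_left _ _

lemma collarKernel_le : collarKernel ε Ω x z ≤ 4 * Metric.infDist x Ω := by
  have h0 : 0 ≤ Metric.infDist x Ω := Metric.infDist_nonneg
  have h1 : 0 ≤ dist x z := dist_nonneg
  exact max_le (by positivity) ((min_le_left _ _).trans (by linarith))

lemma continuous_collarKernel :
    Continuous (Function.uncurry (collarKernel (d := d) ε Ω)) := by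
  have h1 : Continuous fun p : EuclideanSpace ℝ (Fin d) × EuclideanSpace ℝ (Fin d) =>
      Metric.infDist p.1 Ω := (Metric.continuous_infDist_pt Ω).comp continuous_fst
  have h2 : Continuous fun p : EuclideanSpace ℝ (Fin d) × EuclideanSpace ℝ (Fin d) =>
      Metric.infDist p.2 Ωᶜ := (Metric.continuous_infDist_pt Ωᶜ).comp continuous_snd
  unfold Function.uncurry collarKernel
  fun_prop

lemma dist_lt_of_collarKernel_ne_zero (h : collarKernel ε Ω x z ≠ 0) :
    dist x z < 4 * Metric.infDist x Ω := by
  by_contra! h'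
  exact h (max_eq_left ((min_le_left _ _).trans (by linarith)))

lemma lt_infDist_compl_of_collarKernel_ne_zero (h : collarKernel ε Ω x z ≠ 0) :
    ε / 4 * Metric.infDist x Ω < Metric.infDist z Ωᶜ := by
  by_contra! h'
  exact h (max_eq_left ((min_le_right _ _).trans (by linarith)))

lemma mem_of_collarKernel_ne_zero (hε : 0 < ε) (h : collarKernel ε Ω x z ≠ 0) : z ∈ Ω := by
  by_contra hz
  have h1 := lt_infDist_compl_of_collarKernel_ne_zero h
  rw [Metric.infDist_zero_of_mem (show z ∈ Ωᶜ from hz)] at h1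
  have h0 : 0 ≤ Metric.infDist x Ω := Metric.infDist_nonneg
  exact absurd h1 (not_lt.2 (by positivity))

lemma abs_collarKernel_sub_le (hε : 0 < ε) :
    |collarKernel ε Ω y z - collarKernel ε Ω x z| ≤ (5 + ε) * dist x y := by
  have h0 : 0 ≤ dist x y := dist_nonneg
  have h1 := abs_le.1 (abs_infDist_sub_le (x := x) (y := y) (Ω := Ω))
  have h2 := abs_le.1 (abs_dist_sub_le x y z)
  refine (abs_max_sub_max_le_max _ _ _ _).trans (max_le (by simp; positivity) ?_)
  refine (abs_min_sub_min_le_max _ _ _ _).trans (max_le ?_ ?_)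
  · have : 0 ≤ ε * dist x y := by positivity
    rw [abs_le]
    constructor <;> linarith
  · have e : Metric.infDist z Ωᶜ - ε / 4 * Metric.infDist y Ω -
        (Metric.infDist z Ωᶜ - ε / 4 * Metric.infDist x Ω) =
        ε / 4 * (Metric.infDist x Ω - Metric.infDist y Ω) := by ring
    rw [e, abs_mul, abs_of_pos (by positivity : 0 < ε / 4)]
    refine mul_le_mul (by linarith) abs_infDist_sub_le (abs_nonneg _) (by positivity)

lemma integrable_collarKernel : Integrable (collarKernel ε Ω x) := by
  refine Continuous.integrable_of_hasCompactSupport (continuous_collarKernel.uncurry_left x) ?_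
  refine HasCompactSupport.intro (isCompact_closedBall x (4 * Metric.infDist x Ω)) fun z hz => ?_
  by_contra h
  refine hz ?_
  rw [Metric.mem_closedBall, dist_comm]
  exact (dist_lt_of_collarKernel_ne_zero h).le

lemma integrable_collarKernel_mul (hε : 0 < ε) (hΩ : MeasurableSet Ω)
    {f : EuclideanSpace ℝ (Fin d) → ℝ}
    (hf : IntegrableOn f (Metric.ball x (4 * Metric.infDist x Ω) ∩ Ω)) :
    Integrable fun z => collarKernel ε Ω x z * f z := by
  have hS : MeasurableSet (Metric.ball x (4 * Metric.infDist x Ω) ∩ Ω) :=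
    Metric.isOpen_ball.measurableSet.inter hΩ
  have h1 := Integrable.bdd_mul (c := 4 * Metric.infDist x Ω) (hf.integrable_indicator hS)
    (continuous_collarKernel.uncurry_left x).aestronglyMeasurable
    (Filter.Eventually.of_forall fun z => by
      rw [Real.norm_of_nonneg collarKernel_nonneg]
      exact collarKernel_le (ε := ε))
  refine h1.congr (Filter.Eventually.of_forall fun z => ?_)
  by_cases h : collarKernel ε Ω x z = 0
  · simp [h]
  · have hz : z ∈ Metric.ball x (4 * Metric.infDist x Ω) ∩ Ω :=
      ⟨by rw [Metric.mem_ball, dist_comm]; exact dist_lt_of_collarKernel_ne_zero h,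
        mem_of_collarKernel_ne_zero hε h⟩
    simp only [indicator_of_mem hz]

end Kernel

/-- The total mass of the averaging kernel is at least this multiple of `infDist x Ω ^ (d + 1)`. -/
def collarMassConst (d : ℕ) (ε : ℝ) : ℝ :=
  min 2 (ε / 4) * ((ε / 2) ^ d * volume.real (Metric.ball (0 : EuclideanSpace ℝ (Fin d)) 1))

lemma collarMassConst_pos (d : ℕ) {ε : ℝ} (hε : 0 < ε) : 0 < collarMassConst d ε := by
  have hV : 0 < volume.real (Metric.ball (0 : EuclideanSpace ℝ (Fin d)) 1) :=
    ENNReal.toReal_pos (Metric.measure_ball_pos _ _ one_pos).ne' measure_ball_lt_top.ne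
  unfold collarMassConst
  positivity

lemma IsCorkscrew.le_integral_collarKernel {d : ℕ} {ε r : ℝ}
    {Ω : Set (EuclideanSpace ℝ (Fin d))} (h : IsCorkscrew d ε r Ω) (hε : 0 < ε)
    {x : EuclideanSpace ℝ (Fin d)} (hx : 0 < Metric.infDist x Ω) (hxr : Metric.infDist x Ω ≤ r) :
    collarMassConst d ε * Metric.infDist x Ω ^ (d + 1) ≤ ∫ z, collarKernel ε Ω x z := by
  obtain ⟨-, hne, huniv, hcork⟩ := h
  set δ := Metric.infDist x Ω with hδ
  have hxc : x ∈ Ωᶜ := fun hxΩ => hx.ne' (Metric.infDist_zero_of_mem hxΩ)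
  obtain ⟨z₀, hz₀, hxz₀⟩ := exists_mem_frontier_infDist_compl_eq_dist (s := Ωᶜ) hxc
    (fun h => hne.ne_empty (compl_univ_iff.1 h))
  rw [frontier_compl] at hz₀
  rw [compl_compl, ← hδ] at hxz₀
  obtain ⟨y, hy⟩ := hcork z₀ hz₀ δ hx hxr
  have hlow : ∀ z ∈ Metric.ball y (ε / 2 * δ), min 2 (ε / 4) * δ ≤ collarKernel ε Ω x z := by
    intro z hz
    rw [Metric.mem_ball] at hz
    have hεδ : 0 < ε * δ := by positivity
    have hz1 : dist z z₀ < δ :=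
      (hy (show z ∈ Metric.ball y (ε * δ) by rw [Metric.mem_ball]; linarith)).1
    have hz2 : ε / 2 * δ ≤ Metric.infDist z Ωᶜ := by
      refine (Metric.le_infDist ⟨x, hxc⟩).2 fun u hu => ?_
      by_contra! hzu
      refine hu (hy (show u ∈ Metric.ball y (ε * δ) from ?_)).2
      rw [Metric.mem_ball]
      linarith [dist_triangle u z y, dist_comm u z]
    refine le_max_of_le_right (le_min ?_ ?_)
    · have := mul_le_mul_of_nonneg_right (min_le_left 2 (ε / 4)) hx.le
      linarith [dist_triangle x z₀ z, dist_comm z z₀]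
    · have := mul_le_mul_of_nonneg_right (min_le_right 2 (ε / 4)) hx.le
      linarith
  calc collarMassConst d ε * δ ^ (d + 1)
      = ∫ z in Metric.ball y (ε / 2 * δ), min 2 (ε / 4) * δ := by
        rw [setIntegral_const, measureReal_def, Measure.addHaar_ball_of_pos _ _ (by positivity),
          ENNReal.toReal_mul, ENNReal.toReal_ofReal (by positivity), collarMassConst,
          measureReal_def, smul_eq_mul]
        simp only [finrank_euclideanSpace, Fintype.card_fin]
        ring
    _ ≤ ∫ z in Metric.ball y (ε / 2 * δ), collarKernel ε Ω x z := by
        refine setIntegral_mono_on ?_ integrable_collarKernel.integrableOn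
          Metric.isOpen_ball.measurableSet hlow
        exact integrableOn_const measure_ball_lt_top.ne
    _ ≤ ∫ z, collarKernel ε Ω x z :=
        setIntegral_le_integral integrable_collarKernel
          (Filter.Eventually.of_forall fun _ => collarKernel_nonneg)

/-- The total mass of the averaging kernel at `x`. -/
def collarMass {d : ℕ} (ε : ℝ) (Ω : Set (EuclideanSpace ℝ (Fin d)))
    (x : EuclideanSpace ℝ (Fin d)) : ℝ :=
  ∫ z, collarKernel ε Ω x z

/-- The average of `f` against the normalized kernel at `x`. -/
def collarAvg {d : ℕ} (ε : ℝ) (Ω : Set (EuclideanSpace ℝ (Fin d)))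
    (f : EuclideanSpace ℝ (Fin d) → ℝ) (x : EuclideanSpace ℝ (Fin d)) : ℝ :=
  (∫ z, collarKernel ε Ω x z * f z) / collarMass ε Ω x

/-- The normalized averaging kernel, truncated to the collar of width `r` around `Ω`. -/
def collarWeight {d : ℕ} (ε r : ℝ) (Ω : Set (EuclideanSpace ℝ (Fin d)))
    (x z : EuclideanSpace ℝ (Fin d)) : ℝ≥0∞ :=
  if 0 < Metric.infDist x Ω ∧ Metric.infDist x Ω ≤ r then
    ENNReal.ofReal (collarKernel ε Ω x z / collarMass ε Ω x) else 0

/-- A constant for which the normalized averaging kernels satisfy `IsAveraging`. -/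
def collarAvgConst (d : ℕ) (ε : ℝ) : NNReal :=
  Real.toNNReal (max ((5 + ε) * 2 ^ (d + 1) / collarMassConst d ε)
    (4 / collarMassConst d ε * (64 / ε) ^ d *
      volume.real (Metric.ball (0 : EuclideanSpace ℝ (Fin d)) 1)))

section Average

variable {d : ℕ} {ε r : ℝ} {Ω : Set (EuclideanSpace ℝ (Fin d))}
  {f : EuclideanSpace ℝ (Fin d) → ℝ} {x y z : EuclideanSpace ℝ (Fin d)}

lemma measurable_collarMass : Measurable (collarMass (d := d) ε Ω) :=
  (continuous_collarKernel.measurable.stronglyMeasurable.integral_prod_right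
    (ν := volume)).measurable

lemma measurable_collarAvg (hf : Measurable f) : Measurable (collarAvg ε Ω f) := by
  refine Measurable.div ?_ measurable_collarMass
  have h : Measurable (Function.uncurry fun x z => collarKernel ε Ω x z * f z) :=
    continuous_collarKernel.measurable.mul (hf.comp measurable_snd)
  exact (h.stronglyMeasurable.integral_prod_right (ν := volume)).measurable

lemma measurable_collarWeight : Measurable (Function.uncurry (collarWeight (d := d) ε r Ω)) := by
  have hδ : Measurable fun p : EuclideanSpace ℝ (Fin d) × EuclideanSpace ℝ (Fin d) =>
      Metric.infDist p.1 Ω := ((Metric.continuous_infDist_pt Ω).comp continuous_fst).measurable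
  refine Measurable.ite ?_ ?_ measurable_const
  · exact (measurableSet_lt measurable_const hδ).inter (measurableSet_le hδ measurable_const)
  · exact (continuous_collarKernel.measurable.div
      (measurable_collarMass.comp measurable_fst)).ennreal_ofReal

lemma IsCorkscrew.collarMass_pos (h : IsCorkscrew d ε r Ω) (hε : 0 < ε)
    (hx : 0 < Metric.infDist x Ω) (hxr : Metric.infDist x Ω ≤ r) : 0 < collarMass ε Ω x :=
  (mul_pos (collarMassConst_pos d hε) (pow_pos hx _)).trans_le
    (h.le_integral_collarKernel hε hx hxr)

lemma integral_collarKernel_mul_sub (hε : 0 < ε) (hΩ : MeasurableSet Ω)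
    (hf : IntegrableOn f (Metric.ball x (4 * Metric.infDist x Ω) ∩ Ω))
    (hA : 0 < collarMass ε Ω x) (c : ℝ) :
    ∫ z, collarKernel ε Ω x z * (f z - c) = collarMass ε Ω x * (collarAvg ε Ω f x - c) := by
  simp only [mul_sub]
  rw [integral_sub (integrable_collarKernel_mul hε hΩ hf) (integrable_collarKernel.mul_const c),
    integral_mul_const, collarAvg, mul_div_cancel₀ _ hA.ne', collarMass]

lemma integrable_collarKernel_mul_sub (hε : 0 < ε) (hΩ : MeasurableSet Ω)
    (hf : IntegrableOn f (Metric.ball x (4 * Metric.infDist x Ω) ∩ Ω)) (c : ℝ) :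
    Integrable fun z => collarKernel ε Ω x z * (f z - c) := by
  simp only [mul_sub]
  exact (integrable_collarKernel_mul hε hΩ hf).sub (integrable_collarKernel.mul_const c)

lemma IsCorkscrew.lintegral_collarWeight_le (h : IsCorkscrew d ε r Ω) (hε : 0 < ε)
    (x : EuclideanSpace ℝ (Fin d)) : ∫⁻ z, collarWeight ε r Ω x z ≤ 1 := by
  by_cases hx : 0 < Metric.infDist x Ω ∧ Metric.infDist x Ω ≤ r
  · have hA := h.collarMass_pos hε hx.1 hx.2
    simp only [collarWeight, if_pos hx]
    rw [← ofReal_integral_eq_lintegral_ofReal (integrable_collarKernel.div_const _)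
      (Filter.Eventually.of_forall fun z => div_nonneg collarKernel_nonneg hA.le),
      integral_div, ← collarMass, div_self hA.ne', ENNReal.ofReal_one]
  · simp [collarWeight, hx]

lemma IsCorkscrew.collarWeight_le (h : IsCorkscrew d ε r Ω) (hε : 0 < ε)
    (x z : EuclideanSpace ℝ (Fin d)) :
    collarWeight ε r Ω x z ≤
      (Metric.ball z (16 * Metric.infDist z Ωᶜ / ε)).indicator
        (fun _ => ENNReal.ofReal (4 / collarMassConst d ε * (4 / Metric.infDist z Ωᶜ) ^ d)) x := by
  by_cases hw : collarWeight ε r Ω x z = 0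
  · simp [hw]
  have hx : 0 < Metric.infDist x Ω ∧ Metric.infDist x Ω ≤ r := by
    by_contra hx
    exact hw (if_neg hx)
  have ha : collarKernel ε Ω x z ≠ 0 := by
    intro ha
    exact hw (by simp [collarWeight, ha])
  have hκ := collarMassConst_pos d hε
  have hA := h.le_integral_collarKernel hε hx.1 hx.2
  have h1 := dist_lt_of_collarKernel_ne_zero ha
  have h2 := lt_infDist_compl_of_collarKernel_ne_zero ha
  have hxc : x ∈ Ωᶜ := fun hxΩ => hx.1.ne' (Metric.infDist_zero_of_mem hxΩ)
  have h3 : Metric.infDist z Ωᶜ ≤ dist z x := Metric.infDist_le_dist_of_mem hxc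
  rw [dist_comm] at h3
  have hδ := hx.1
  have hρ : 0 < Metric.infDist z Ωᶜ := lt_trans (by positivity) h2
  have hmem : x ∈ Metric.ball z (16 * Metric.infDist z Ωᶜ / ε) := by
    rw [Metric.mem_ball, lt_div_iff₀ hε]
    nlinarith
  rw [indicator_of_mem hmem, collarWeight, if_pos hx]
  refine ENNReal.ofReal_le_ofReal ?_
  calc collarKernel ε Ω x z / collarMass ε Ω x
      ≤ 4 * Metric.infDist x Ω / (collarMassConst d ε * Metric.infDist x Ω ^ (d + 1)) :=
        div_le_div₀ (by positivity) collarKernel_le (by positivity) hA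
    _ = 4 / collarMassConst d ε * (1 / Metric.infDist x Ω) ^ d := by
        rw [one_div, inv_pow, pow_succ]
        field_simp
    _ ≤ 4 / collarMassConst d ε * (4 / Metric.infDist z Ωᶜ) ^ d := by
        gcongr ?_ * ?_ ^ d
        rw [div_le_div_iff₀ hδ hρ]
        linarith

lemma IsCorkscrew.lintegral_collarWeight_left_le (h : IsCorkscrew d ε r Ω) (hε : 0 < ε)
    (z : EuclideanSpace ℝ (Fin d)) :
    ∫⁻ x, collarWeight ε r Ω x z ≤ collarAvgConst d ε := by
  have hκ := collarMassConst_pos d hε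
  refine (lintegral_mono fun x => h.collarWeight_le hε x z).trans ?_
  rw [lintegral_indicator_const Metric.isOpen_ball.measurableSet]
  rcases (Metric.infDist_nonneg (x := z) (s := Ωᶜ)).eq_or_lt with h0 | hρ
  · simp [← h0]
  rw [Measure.addHaar_ball_of_pos _ _ (by positivity),
    ← ENNReal.ofReal_toReal (measure_ball_lt_top (μ := volume)
      (x := (0 : EuclideanSpace ℝ (Fin d))) (r := 1)).ne,
    ← ENNReal.ofReal_mul (by positivity), ← ENNReal.ofReal_mul (by positivity)]
  refine ENNReal.ofReal_le_ofReal ((le_of_eq ?_).trans (le_max_right _ _))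
  rw [measureReal_def, finrank_euclideanSpace, Fintype.card_fin, mul_assoc, mul_assoc,
    ← mul_assoc ((4 / _) ^ d), ← mul_pow]
  congr 3
  field_simp
  norm_num

lemma IsCorkscrew.enorm_collarAvg_sub_const_le (h : IsCorkscrew d ε r Ω) (hε : 0 < ε)
    (hf : ∀ x R, IntegrableOn f (Metric.ball x R ∩ Ω)) (hx : 0 < Metric.infDist x Ω)
    (hxr : Metric.infDist x Ω ≤ r) (c : ℝ) :
    ‖collarAvg ε Ω f x - c‖ₑ ≤ ∫⁻ z, collarWeight ε r Ω x z * ‖f z - c‖ₑ := by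
  have hA := h.collarMass_pos hε hx hxr
  have e : collarAvg ε Ω f x - c =
      ∫ z, collarKernel ε Ω x z / collarMass ε Ω x * (f z - c) := by
    simp only [div_mul_eq_mul_div]
    rw [integral_div, integral_collarKernel_mul_sub hε h.1.measurableSet (hf _ _) hA c,
      mul_div_cancel_left₀ _ hA.ne']
  rw [e]
  refine (enorm_integral_le_lintegral_enorm _).trans_eq (lintegral_congr fun z => ?_)
  rw [enorm_mul, collarWeight, if_pos ⟨hx, hxr⟩,
    Real.enorm_of_nonneg (div_nonneg collarKernel_nonneg hA.le)]

lemma IsCorkscrew.enorm_collarAvg_sub_le (h : IsCorkscrew d ε r Ω) (hε : 0 < ε)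
    (hf : ∀ x R, IntegrableOn f (Metric.ball x R ∩ Ω))
    (hx : 0 < Metric.infDist x Ω) (hxr : Metric.infDist x Ω ≤ r)
    (hy : 0 < Metric.infDist y Ω) (hyr : Metric.infDist y Ω ≤ r)
    (hxy : dist x y ≤ Metric.infDist x Ω / 2) :
    ‖collarAvg ε Ω f x - collarAvg ε Ω f y‖ₑ ≤
      collarAvgConst d ε * ENNReal.ofReal (dist x y / Metric.infDist x Ω ^ (d + 1)) *
      ∫⁻ z in Metric.ball x (8 * Metric.infDist x Ω) ∩ Ω, ‖f z - collarAvg ε Ω f x‖ₑ := by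
  have hΩ := h.1.measurableSet
  have hκ := collarMassConst_pos d hε
  have hAx := h.collarMass_pos hε hx hxr
  have hAy := h.collarMass_pos hε hy hyr
  have hδ := abs_le.1 (abs_infDist_sub_le (x := x) (y := y) (Ω := Ω))
  set δ := Metric.infDist x Ω with hδdef
  set c := collarAvg ε Ω f x
  have hAy' : collarMassConst d ε * (δ / 2) ^ (d + 1) ≤ collarMass ε Ω y := by
    refine le_trans ?_ (h.le_integral_collarKernel hε hy hyr)
    gcongr
    linarith
  have e : collarAvg ε Ω f y - c = (collarMass ε Ω y)⁻¹ *
      ∫ z, (collarKernel ε Ω y z - collarKernel ε Ω x z) * (f z - c) := by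
    simp only [sub_mul (collarKernel ε Ω y _)]
    rw [integral_sub (integrable_collarKernel_mul_sub hε hΩ (hf _ _) c)
        (integrable_collarKernel_mul_sub hε hΩ (hf _ _) c),
      integral_collarKernel_mul_sub hε hΩ (hf _ _) hAy,
      integral_collarKernel_mul_sub hε hΩ (hf _ _) hAx, sub_self, mul_zero, sub_zero,
      inv_mul_cancel_left₀ hAy.ne']
  have h_int : ‖∫ z, (collarKernel ε Ω y z - collarKernel ε Ω x z) * (f z - c)‖ₑ ≤
      ENNReal.ofReal ((5 + ε) * dist x y) *
        ∫⁻ z in Metric.ball x (8 * δ) ∩ Ω, ‖f z - c‖ₑ := by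
    rw [← lintegral_const_mul' _ _ ENNReal.ofReal_ne_top,
      ← lintegral_indicator (Metric.isOpen_ball.measurableSet.inter hΩ)]
    refine (enorm_integral_le_lintegral_enorm _).trans (lintegral_mono fun z => ?_)
    by_cases hz : collarKernel ε Ω y z = 0 ∧ collarKernel ε Ω x z = 0
    · simp [hz]
    have hzS : z ∈ Metric.ball x (8 * δ) ∩ Ω := by
      rw [mem_inter_iff, Metric.mem_ball, dist_comm]
      rcases not_and_or.1 hz with hz | hz
      · refine ⟨?_, mem_of_collarKernel_ne_zero hε hz⟩
        linarith [dist_lt_of_collarKernel_ne_zero hz, dist_triangle x y z]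
      · refine ⟨?_, mem_of_collarKernel_ne_zero hε hz⟩
        linarith [dist_lt_of_collarKernel_ne_zero hz]
    rw [indicator_of_mem hzS, enorm_mul, Real.enorm_eq_ofReal_abs]
    gcongr
    exact abs_collarKernel_sub_le hε
  rw [← enorm_neg, neg_sub, e, enorm_mul, Real.enorm_of_nonneg (inv_nonneg.2 hAy.le)]
  refine (mul_le_mul_right h_int _).trans ?_
  rw [← mul_assoc, ← ENNReal.ofReal_mul (inv_nonneg.2 hAy.le)]
  gcongr
  rw [collarAvgConst, ← ENNReal.ofReal, ← ENNReal.ofReal_mul (by positivity)]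
  refine ENNReal.ofReal_le_ofReal ?_
  calc (collarMass ε Ω y)⁻¹ * ((5 + ε) * dist x y)
      ≤ (collarMassConst d ε * (δ / 2) ^ (d + 1))⁻¹ * ((5 + ε) * dist x y) := by gcongr
    _ = (5 + ε) * 2 ^ (d + 1) / collarMassConst d ε * (dist x y / δ ^ (d + 1)) := by
        rw [div_pow]
        field_simp
    _ ≤ _ := by
        gcongr
        exact le_max_left _ _

theorem IsCorkscrew.isAveraging (h : IsCorkscrew d ε r Ω) (hε : 0 < ε) (hfm : Measurable f)
    (hf : ∀ x R, IntegrableOn f (Metric.ball x R ∩ Ω)) :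
    IsAveraging r (collarAvgConst d ε) Ω f (collarAvg ε Ω f) (collarWeight ε r Ω) where
  measurable_weight := measurable_collarWeight
  measurable_avg := measurable_collarAvg hfm
  mass_le := h.lintegral_collarWeight_le hε
  comass_le := h.lintegral_collarWeight_left_le hε
  supp x z hw := by
    have ha : collarKernel ε Ω x z ≠ 0 := fun ha => hw (by simp [collarWeight, ha])
    exact ⟨mem_of_collarKernel_ne_zero hε ha, dist_lt_of_collarKernel_ne_zero ha⟩
  dev_le _ hx hxr c := h.enorm_collarAvg_sub_const_le hε hf hx hxr c
  lip _ _ hx hxr hy hyr hxy := h.enorm_collarAvg_sub_le hε hf hx hxr hy hyr hxy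

lemma integrableOn_ball_inter_of_lpNormOn_ne_top {p : ℝ} (hp : 1 ≤ p) (hf : Measurable f)
    (hfp : lpNormOn d Ω f p ≠ ⊤) (x : EuclideanSpace ℝ (Fin d)) (R : ℝ) :
    IntegrableOn f (Metric.ball x R ∩ Ω) := by
  have h : MemLp f (ENNReal.ofReal p) (volume.restrict Ω) :=
    ⟨hf.aestronglyMeasurable, hfp.lt_top⟩
  have : IsFiniteMeasure (volume.restrict (Metric.ball x R ∩ Ω)) :=
    ⟨by
      rw [Measure.restrict_apply_univ]
      exact (measure_mono inter_subset_left).trans_lt measure_ball_lt_top⟩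
  exact (h.mono_measure (Measure.restrict_mono inter_subset_right le_rfl)).integrable
    (ENNReal.one_le_ofReal.2 hp)

end Average

/-- **Extension theorem for smoothness below one.**  Let `Ω ⊊ ℝ^d` be an interior
`(ε,δ)`-corkscrew domain, `1 ≤ p < ∞`, `1 ≤ q ≤ ∞` and `0 < s < 1`.  There exist
`ℓ₀ > 0` and `C ≥ 1`, depending only on `d, ε, δ, s, p, q`, such that every measurable
`f : Ω → ℝ` with `‖f‖_{L^p(Ω)} + ‖f‖_{Ḟ^{s,Cℓ₀}_{p,q,1}(Ω)} < ∞` admits a measurable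
extension `F : ℝ^d → ℝ` (agreeing with `f` a.e. on `Ω`) with
`‖F‖_{L^p(ℝ^d)} + ‖F‖_{Ḟ^{s,1}_{p,q,1}(ℝ^d)} ≤ C (‖f‖_{L^p(Ω)} + ‖f‖_{Ḟ^{s,Cℓ₀}_{p,q,1}(Ω)})`. -/
theorem extension_smoothness_below_one (d : ℕ) (ε δ : ℝ) (hε : 0 < ε) (hδ : 0 < δ)
    (p : ℝ) (hp : 1 ≤ p) (q : ℝ≥0∞) (hq : 1 ≤ q)
    (s : ℝ) (hs0 : 0 < s) (hs1 : s < 1) :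
    ∃ ℓ₀ C : ℝ, 0 < ℓ₀ ∧ 1 ≤ C ∧
      ∀ Ω : Set (EuclideanSpace ℝ (Fin d)), IsCorkscrew d ε δ Ω →
        ∀ f : EuclideanSpace ℝ (Fin d) → ℝ, Measurable f →
          lpNormOn d Ω f p + triebelSeminorm d Ω f s (C * ℓ₀) p q 1 ≠ ⊤ →
          ∃ F : EuclideanSpace ℝ (Fin d) → ℝ, Measurable F ∧
            (∀ᵐ x ∂(volume.restrict Ω), F x = f x) ∧
            lpNormOn d Set.univ F p + triebelSeminorm d Set.univ F s 1 p q 1 ≤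
              ENNReal.ofReal C *
                (lpNormOn d Ω f p + triebelSeminorm d Ω f s (C * ℓ₀) p q 1) := by
  set K := collarNormConst d δ (collarAvgConst d ε) s
  set C := max 1 K.toReal
  have hC1 : 1 ≤ C := le_max_left _ _
  have hC0 : 0 < C := zero_lt_one.trans_le hC1
  refine ⟨4 * δ / C, C, by positivity, hC1, fun Ω h f hf hfin => ?_⟩
  rw [mul_div_cancel₀ _ hC0.ne'] at hfin ⊢
  have hfi := integrableOn_ball_inter_of_lpNormOn_ne_top hp hf (ENNReal.add_ne_top.1 hfin).1
  have H := h.isAveraging hε hf hfi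
  have hΩ := h.1.measurableSet
  refine ⟨collarExtension δ Ω f (collarAvg ε Ω f),
    measurable_collarExtension hΩ hf H.measurable_avg, ?_, ?_⟩
  · filter_upwards [ae_restrict_mem hΩ] with x hx using collarExtension_of_mem hx
  refine (H.norm_collarExtension_le hδ hΩ (h.ae_mem_or_infDist_pos hε hδ) hf hs0 hs1 hp hq).trans
    (mul_le_mul_left ?_ _)
  rw [← ENNReal.ofReal_toReal (collarNormConst_ne_top d δ (collarAvgConst d ε) s)]
  exact ENNReal.ofReal_le_ofReal (le_max_right _ _)
end
end

section
/- Let d ∈ ℕ, let Ω ⊊ ℝ^d be an interior (ε,δ)-corkscrew domain, let 1 ≤ p < ∞, 1 ≤ q ≤ ∞, 0 < s < 1 and 0 < ρ < 1. Then there is a constant C, depending only on d, ε, δ, s, p, q and ρ, such that for every measurable f : Ω → ℝ, ‖f‖_{L^p(Ω)} + ‖f‖_{Ḟ^{s,1}_{p,q,1}(Ω)} ≤ C ( ‖f‖_{L^p(Ω)} + ‖f‖_{Ḟ^{s,ρ}_{p,q,1}(Ω)} ); in particular the norms at scale ρ and at scale 1 are comparable on Ω. -/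
open Set MeasureTheory ENNReal

noncomputable section

/-- The mass of `|f|` on the unit ball around `x`, inside `U`. -/
def unitBallMass (d : ℕ) (U : Set (EuclideanSpace ℝ (Fin d)))
    (f : EuclideanSpace ℝ (Fin d) → ℝ) (x : EuclideanSpace ℝ (Fin d)) : ℝ≥0∞ :=
  ∫⁻ y in Metric.ball x 1 ∩ U, ‖f y‖ₑ

section

variable {d : ℕ} {U : Set (EuclideanSpace ℝ (Fin d))} {f : EuclideanSpace ℝ (Fin d) → ℝ}

lemma lintegral_ball_inter_eq_indicator
    (g : EuclideanSpace ℝ (Fin d) → ℝ≥0∞) (x : EuclideanSpace ℝ (Fin d)) :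
    ∫⁻ y in Metric.ball x 1 ∩ U, g y =
      ∫⁻ y in U, {z : EuclideanSpace ℝ (Fin d) × EuclideanSpace ℝ (Fin d) |
        dist z.2 z.1 < 1}.indicator (fun z => g z.2) (x, y) := by
  rw [← Measure.restrict_restrict Metric.isOpen_ball.measurableSet,
    ← lintegral_indicator Metric.isOpen_ball.measurableSet]
  rfl

lemma measurable_indicator_dist_lt_one {g : EuclideanSpace ℝ (Fin d) → ℝ≥0∞}
    (hg : Measurable g) :
    Measurable ({z : EuclideanSpace ℝ (Fin d) × EuclideanSpace ℝ (Fin d) |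
      dist z.2 z.1 < 1}.indicator (fun z => g z.2)) :=
  (hg.comp measurable_snd).indicator
    (measurableSet_lt (measurable_snd.dist measurable_fst) measurable_const)

lemma measurable_unitBallMass (hf : Measurable f) :
    Measurable (unitBallMass d U f) := by
  have h := (measurable_indicator_dist_lt_one (d := d)
    hf.enorm).lintegral_prod_right' (ν := volume.restrict U)
  convert h using 1
  ext x
  exact lintegral_ball_inter_eq_indicator _ x

lemma volume_ball_inter_le (x : EuclideanSpace ℝ (Fin d)) :
    volume (Metric.ball x 1 ∩ U) ≤
      volume (Metric.ball (0 : EuclideanSpace ℝ (Fin d)) 1) :=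
  (measure_mono inter_subset_left).trans_eq (Measure.addHaar_ball_center _ _ _)

lemma unitBallMass_rpow_le (hf : Measurable f) {p : ℝ} (hp : 1 ≤ p)
    (x : EuclideanSpace ℝ (Fin d)) :
    unitBallMass d U f x ^ p ≤
      volume (Metric.ball (0 : EuclideanSpace ℝ (Fin d)) 1) ^ (p - 1) *
        ∫⁻ y in Metric.ball x 1 ∩ U, ‖f y‖ₑ ^ p := by
  have hp0 : 0 < p := by linarith
  have h := eLpNorm_le_eLpNorm_mul_rpow_measure_univ (p := 1) (q := ENNReal.ofReal p)
    (μ := volume.restrict (Metric.ball x 1 ∩ U)) (f := f)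
    (by simpa using hp) hf.aestronglyMeasurable
  rw [eLpNorm_one_eq_lintegral_enorm,
    eLpNorm_eq_lintegral_rpow_enorm_toReal (by simpa using hp0) ofReal_ne_top,
    toReal_ofReal hp0.le, Measure.restrict_apply_univ] at h
  calc unitBallMass d U f x ^ p
      ≤ _ := ENNReal.rpow_le_rpow h hp0.le
    _ = volume (Metric.ball x 1 ∩ U) ^ (p - 1) *
          ∫⁻ y in Metric.ball x 1 ∩ U, ‖f y‖ₑ ^ p := by
        rw [ENNReal.mul_rpow_of_nonneg _ _ hp0.le, ← ENNReal.rpow_mul, ← ENNReal.rpow_mul,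
          mul_comm]
        congr 2
        · simp; field_simp
        · rw [one_div_mul_cancel hp0.ne', ENNReal.rpow_one]
    _ ≤ _ := by
        gcongr ?_ * _
        exact ENNReal.rpow_le_rpow (volume_ball_inter_le x) (by linarith)

lemma lintegral_unitBallMass_rpow_le (hf : Measurable f)
    {p : ℝ} (hp : 1 ≤ p) :
    ∫⁻ x in U, unitBallMass d U f x ^ p ≤
      volume (Metric.ball (0 : EuclideanSpace ℝ (Fin d)) 1) ^ p *
        ∫⁻ y in U, ‖f y‖ₑ ^ p := by
  set V := volume (Metric.ball (0 : EuclideanSpace ℝ (Fin d)) 1)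
  have hVtop : V ≠ ⊤ := measure_ball_lt_top.ne
  have hV0 : V ≠ 0 := (Metric.measure_ball_pos _ _ one_pos).ne'
  have hg : Measurable fun y => ‖f y‖ₑ ^ p := hf.enorm.pow_const p
  calc ∫⁻ x in U, unitBallMass d U f x ^ p
      ≤ ∫⁻ x in U, V ^ (p - 1) * ∫⁻ y in Metric.ball x 1 ∩ U, ‖f y‖ₑ ^ p :=
        lintegral_mono fun x => unitBallMass_rpow_le hf hp x
    _ = V ^ (p - 1) * ∫⁻ x in U, ∫⁻ y in Metric.ball x 1 ∩ U, ‖f y‖ₑ ^ p :=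
        lintegral_const_mul' _ _ (ENNReal.rpow_ne_top_of_nonneg (by linarith) hVtop)
    _ ≤ V ^ (p - 1) * (V * ∫⁻ y in U, ‖f y‖ₑ ^ p) := by
        gcongr V ^ (p - 1) * ?_
        simp_rw [lintegral_ball_inter_eq_indicator]
        rw [lintegral_lintegral_swap (f := fun x y => {z : EuclideanSpace ℝ (Fin d) ×
            EuclideanSpace ℝ (Fin d) | dist z.2 z.1 < 1}.indicator (fun z => ‖f z.2‖ₑ ^ p) (x, y))
            (measurable_indicator_dist_lt_one hg).aemeasurable,
          ← lintegral_const_mul' _ _ hVtop]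
        refine lintegral_mono fun y => ?_
        calc _ = ∫⁻ x in U, (Metric.ball y 1).indicator (fun _ => ‖f y‖ₑ ^ p) x := by
              refine lintegral_congr fun x => ?_
              simp [indicator, dist_comm]
          _ = ‖f y‖ₑ ^ p * volume (Metric.ball y 1 ∩ U) := by
              rw [lintegral_indicator_const Metric.isOpen_ball.measurableSet,
                Measure.restrict_apply Metric.isOpen_ball.measurableSet]
          _ ≤ V * ‖f y‖ₑ ^ p := by
              rw [mul_comm]
              gcongr
              exact volume_ball_inter_le y
    _ = V ^ p * ∫⁻ y in U, ‖f y‖ₑ ^ p := by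
        rw [← mul_assoc]
        congr 1
        nth_rewrite 2 [← ENNReal.rpow_one V]
        rw [← ENNReal.rpow_add _ _ hV0 hVtop, sub_add_cancel]

lemma triebelInner_one_le (hf : Measurable f) {s ρ t : ℝ} (hs : 0 < s) (hρ : 0 < ρ)
    (hρt : ρ ≤ t) (ht : t ≤ 1) (x : EuclideanSpace ℝ (Fin d)) :
    triebelInner d U f s 1 x t ≤
      ENNReal.ofReal (ρ ^ (-(s + (d : ℝ)))) *
        (volume (Metric.ball (0 : EuclideanSpace ℝ (Fin d)) 1) * ‖f x‖ₑ +
          unitBallMass d U f x) := by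
  simp only [triebelInner, toReal_one, div_one, ENNReal.one_ne_top, if_false, ENNReal.rpow_one]
  gcongr ?_ * ?_
  · exact ENNReal.ofReal_le_ofReal
      (Real.rpow_le_rpow_of_nonpos hρ hρt (neg_nonpos.2 (by positivity)))
  · calc ∫⁻ y in Metric.ball x t ∩ U, ENNReal.ofReal |f x - f y|
        ≤ ∫⁻ y in Metric.ball x 1 ∩ U, ENNReal.ofReal |f x - f y| :=
          lintegral_mono_set (inter_subset_inter_left _ (Metric.ball_subset_ball ht))
      _ ≤ ∫⁻ y in Metric.ball x 1 ∩ U, (‖f x‖ₑ + ‖f y‖ₑ) := by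
          refine lintegral_mono fun y => ?_
          rw [← Real.norm_eq_abs, ofReal_norm]
          exact enorm_sub_le
      _ = ‖f x‖ₑ * volume (Metric.ball x 1 ∩ U) + unitBallMass d U f x := by
          rw [lintegral_add_right _ hf.enorm, setLIntegral_const]
          rfl
      _ ≤ _ := by
          rw [mul_comm]
          gcongr ?_ * _ + _
          exact volume_ball_inter_le x

end

/-- The `L^q((0,r), dt/t)` seminorm on `(0,1)` is controlled by the one on `(0,ρ)` and a
uniform bound on `[ρ,1)`. -/
lemma scaleNorm_one_le {q : ℝ≥0∞} (hq : 1 ≤ q) {ρ : ℝ} (hρ0 : 0 < ρ) (hρ1 : ρ < 1)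
    (F : ℝ → ℝ≥0∞) (G : ℝ≥0∞) (hFG : ∀ t, ρ ≤ t → t ≤ 1 → F t ≤ G) :
    (if q = ⊤ then essSup F (volume.restrict (Set.Ioo (0 : ℝ) 1))
      else (∫⁻ t in Set.Ioo (0 : ℝ) 1, F t ^ q.toReal * ENNReal.ofReal t⁻¹) ^ (1 / q.toReal)) ≤
    (if q = ⊤ then essSup F (volume.restrict (Set.Ioo (0 : ℝ) ρ))
      else (∫⁻ t in Set.Ioo (0 : ℝ) ρ, F t ^ q.toReal * ENNReal.ofReal t⁻¹) ^ (1 / q.toReal)) +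
      ENNReal.ofReal ρ⁻¹ * G := by
  have hR : 1 ≤ ENNReal.ofReal ρ⁻¹ := by
    rw [← ENNReal.ofReal_one]
    exact ENNReal.ofReal_le_ofReal ((one_le_inv₀ hρ0).2 hρ1.le)
  split_ifs with h
  · refine essSup_le_of_ae_le _ ?_
    have h1 := (ae_restrict_iff' measurableSet_Ioo).1
      (ENNReal.ae_le_essSup (μ := volume.restrict (Set.Ioo (0 : ℝ) ρ)) F)
    rw [Filter.EventuallyLE, ae_restrict_iff' measurableSet_Ioo]
    filter_upwards [h1] with t ht htI
    rcases lt_or_ge t ρ with h' | h'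
    · exact (ht ⟨htI.1, h'⟩).trans le_self_add
    · calc F t ≤ 1 * G := by simpa using hFG t h' htI.2.le
        _ ≤ ENNReal.ofReal ρ⁻¹ * G := by gcongr
        _ ≤ _ := le_add_self
  · have hq1 : 1 ≤ q.toReal := by simpa using ENNReal.toReal_mono h hq
    have hq0 : 0 < q.toReal := by linarith
    have hqi : 0 ≤ 1 / q.toReal := by positivity
    rw [← Ioo_union_Ico_eq_Ioo hρ0 hρ1.le]
    refine (ENNReal.rpow_le_rpow (lintegral_union_le _ _ _) hqi).trans ?_
    refine (ENNReal.rpow_add_le_add_rpow _ _ hqi (by rwa [div_le_one hq0])).trans ?_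
    gcongr
    calc (∫⁻ t in Ico ρ 1, F t ^ q.toReal * ENNReal.ofReal t⁻¹) ^ (1 / q.toReal)
        ≤ (∫⁻ _ in Ico ρ 1, G ^ q.toReal * ENNReal.ofReal ρ⁻¹) ^ (1 / q.toReal) := by
          refine ENNReal.rpow_le_rpow (setLIntegral_mono' measurableSet_Ico fun t ht => ?_) hqi
          gcongr
          · exact hFG t ht.1 ht.2.le
          · exact ht.1
      _ ≤ (G ^ q.toReal * ENNReal.ofReal ρ⁻¹) ^ (1 / q.toReal) := by
          refine ENNReal.rpow_le_rpow ?_ hqi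
          rw [setLIntegral_const, Real.volume_Ico]
          refine mul_le_of_le_one_right' ?_
          rw [ENNReal.ofReal_le_one]
          linarith
      _ = ENNReal.ofReal ρ⁻¹ ^ (1 / q.toReal) * G := by
          rw [ENNReal.mul_rpow_of_nonneg _ _ hqi, ← ENNReal.rpow_mul,
            mul_one_div_cancel hq0.ne', ENNReal.rpow_one, mul_comm]
      _ ≤ ENNReal.ofReal ρ⁻¹ * G := by
          gcongr
          calc _ ≤ ENNReal.ofReal ρ⁻¹ ^ (1 : ℝ) :=
                ENNReal.rpow_le_rpow_of_exponent_le hR (by rwa [div_le_one hq0])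
            _ = _ := ENNReal.rpow_one _

/-- **Comparability of scales.**  Let `Ω ⊊ ℝ^d` be an interior `(ε,δ)`-corkscrew
domain, `1 ≤ p < ∞`, `1 ≤ q ≤ ∞`, `0 < s < 1` and `0 < ρ < 1`.  There is a constant
`C` depending only on `d, ε, δ, s, p, q, ρ` such that for every measurable `f : Ω → ℝ`,
`‖f‖_{L^p(Ω)} + ‖f‖_{Ḟ^{s,1}_{p,q,1}(Ω)} ≤ C (‖f‖_{L^p(Ω)} + ‖f‖_{Ḟ^{s,ρ}_{p,q,1}(Ω)})`;
in particular the norms at scale `ρ` and at scale `1` are comparable on `Ω`. -/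
theorem scale_comparability (d : ℕ) (ε δ : ℝ) (hε : 0 < ε) (hδ : 0 < δ)
    (p : ℝ) (hp : 1 ≤ p) (q : ℝ≥0∞) (hq : 1 ≤ q)
    (s : ℝ) (hs0 : 0 < s) (hs1 : s < 1) (ρ : ℝ) (hρ0 : 0 < ρ) (hρ1 : ρ < 1) :
    ∃ C : ℝ, 0 < C ∧
      ∀ Ω : Set (EuclideanSpace ℝ (Fin d)), IsCorkscrew d ε δ Ω →
        ∀ f : EuclideanSpace ℝ (Fin d) → ℝ, Measurable f →
          lpNormOn d Ω f p + triebelSeminorm d Ω f s 1 p q 1 ≤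
            ENNReal.ofReal C *
              (lpNormOn d Ω f p + triebelSeminorm d Ω f s ρ p q 1) := by
  have hp0 : 0 < p := by linarith
  have hpi : 0 ≤ 1 / p := by positivity
  set V := volume (Metric.ball (0 : EuclideanSpace ℝ (Fin d)) 1)
  have hVtop : V ≠ ⊤ := measure_ball_lt_top.ne
  set K : ℝ≥0∞ := ENNReal.ofReal ρ⁻¹ * ENNReal.ofReal (ρ ^ (-(s + (d : ℝ))))
  have hKtop : K ≠ ⊤ := ENNReal.mul_ne_top ofReal_ne_top ofReal_ne_top
  set T : ℝ≥0∞ := 2 ^ (p - 1)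
  have hTtop : T ≠ ⊤ := ENNReal.rpow_ne_top_of_nonneg (by linarith) (by simp)
  set D : ℝ≥0∞ := K ^ p * (T * (V ^ p + V ^ p)) with hD
  have hVp : V ^ p ≠ ⊤ := ENNReal.rpow_ne_top_of_nonneg hp0.le hVtop
  have hKp : K ^ p ≠ ⊤ := ENNReal.rpow_ne_top_of_nonneg hp0.le hKtop
  have hDtop : D ≠ ⊤ :=
    ENNReal.mul_ne_top hKp (ENNReal.mul_ne_top hTtop (ENNReal.add_ne_top.2 ⟨hVp, hVp⟩))
  set C : ℝ≥0∞ := 1 + T ^ (1 / p) * (1 + D ^ (1 / p)) with hC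
  have hCtop : C ≠ ⊤ := ENNReal.add_ne_top.2 ⟨by simp, ENNReal.mul_ne_top
    (ENNReal.rpow_ne_top_of_nonneg hpi hTtop)
    (ENNReal.add_ne_top.2 ⟨by simp, ENNReal.rpow_ne_top_of_nonneg hpi hDtop⟩)⟩
  have hC0 : C ≠ 0 := by simp [hC]
  refine ⟨C.toReal, ENNReal.toReal_pos hC0 hCtop, fun Ω _ f hf => ?_⟩
  have hN : lpNormOn d Ω f p = (∫⁻ y in Ω, ‖f y‖ₑ ^ p) ^ (1 / p) := by
    rw [lpNormOn, eLpNorm_eq_lintegral_rpow_enorm_toReal (by simpa using hp0) ofReal_ne_top,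
      toReal_ofReal hp0.le]
  set G : EuclideanSpace ℝ (Fin d) → ℝ≥0∞ :=
    fun x => K * (V * ‖f x‖ₑ + unitBallMass d Ω f x) with hG
  have hGm : Measurable G :=
    ((hf.enorm.const_mul V).add (measurable_unitBallMass hf)).const_mul K
  have hGint : ∫⁻ x in Ω, G x ^ p ≤ D * ∫⁻ y in Ω, ‖f y‖ₑ ^ p := by
    calc ∫⁻ x in Ω, G x ^ p
        ≤ ∫⁻ x in Ω, K ^ p * (T * ((V ^ p * ‖f x‖ₑ ^ p) + unitBallMass d Ω f x ^ p)) := by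
          refine lintegral_mono fun x => ?_
          simp only [hG]
          rw [ENNReal.mul_rpow_of_nonneg _ _ hp0.le, ← ENNReal.mul_rpow_of_nonneg V _ hp0.le]
          gcongr
          exact ENNReal.rpow_add_le_mul_rpow_add_rpow _ _ hp
      _ = K ^ p * (T * (V ^ p * (∫⁻ x in Ω, ‖f x‖ₑ ^ p) +
            ∫⁻ x in Ω, unitBallMass d Ω f x ^ p)) := by
          rw [lintegral_const_mul' _ _ hKp, lintegral_const_mul' _ _ hTtop,
            lintegral_add_right _ ((measurable_unitBallMass hf).pow_const p),
            lintegral_const_mul' _ _ hVp]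
      _ ≤ K ^ p * (T * (V ^ p * (∫⁻ x in Ω, ‖f x‖ₑ ^ p) +
            V ^ p * ∫⁻ x in Ω, ‖f x‖ₑ ^ p)) := by
          gcongr
          exact lintegral_unitBallMass_rpow_le hf hp
      _ = _ := by rw [hD]; ring
  have hS : triebelSeminorm d Ω f s 1 p q 1 ≤
      T ^ (1 / p) * (triebelSeminorm d Ω f s ρ p q 1 + D ^ (1 / p) * lpNormOn d Ω f p) := by
    rw [hN, ← ENNReal.mul_rpow_of_nonneg _ _ hpi]
    unfold triebelSeminorm
    refine le_trans (ENNReal.rpow_le_rpow (lintegral_mono fun x => ENNReal.rpow_le_rpow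
      (scaleNorm_one_le hq hρ0 hρ1 _ _ fun t h1 h2 =>
        triebelInner_one_le hf hs0 hρ0 h1 h2 x) hp0.le) hpi) ?_
    refine le_trans (ENNReal.rpow_le_rpow (lintegral_mono fun x =>
      ENNReal.rpow_add_le_mul_rpow_add_rpow _ _ hp) hpi) ?_
    rw [lintegral_const_mul' _ _ hTtop, ENNReal.mul_rpow_of_nonneg _ _ hpi]
    gcongr
    refine le_trans (ENNReal.rpow_le_rpow ?_ hpi)
      (ENNReal.rpow_add_le_add_rpow _ _ hpi (by rwa [div_le_one hp0]))
    simp_rw [← mul_assoc (ENNReal.ofReal ρ⁻¹)]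
    rw [lintegral_add_right _ (hGm.pow_const p)]
    gcongr
  rw [ENNReal.ofReal_toReal hCtop]
  refine (add_le_add_right hS _).trans ?_
  set N := lpNormOn d Ω f p
  set S := triebelSeminorm d Ω f s ρ p q 1
  calc N + T ^ (1 / p) * (S + D ^ (1 / p) * N)
      ≤ (N + T ^ (1 / p) * (S + D ^ (1 / p) * N)) +
          (S + T ^ (1 / p) * (N + D ^ (1 / p) * S)) := le_self_add
    _ = C * (N + S) := by rw [hC]; ring
end
end
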